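/- arXiv:1512.06089 — 2 statements merged into one kernel-verified Lean document; each statement's English description precedes it below -/
import Mathlib

section
/- For every u ∈ (0,1), the limit as μ → 1− of φ(u,μ) := dc²(K(1−μ)u | 1−μ) − dc²(K(μ)u | μ) equals tan²(πu/2). -/
noncomputable section

open Complex Filter Set Asymptotics

/-- Complete elliptic integral of the first kind with complex parameter `m`,
using the principal branch of the square root. -/
def ellK (m : ℂ) : ℂ :=
  ∫ t in (0:ℝ)..1, 1 / ((1 - (t : ℂ) ^ 2) * (1 - m * (t : ℂ) ^ 2)) ^ ((1 : ℂ) / 2)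

/-- The nome `q = exp (-π K(1-m)/K(m))`. -/
def nome (m : ℂ) : ℂ := Complex.exp (-(Real.pi : ℂ) * ellK (1 - m) / ellK m)

/-- Jacobi theta function θ₁(z, q). -/
def theta1 (z q : ℂ) : ℂ :=
  2 * ∑' n : ℕ, (-1 : ℂ) ^ n * q ^ (((n : ℂ) + 1 / 2) ^ 2) *
    Complex.sin ((2 * (n : ℂ) + 1) * z)

/-- Jacobi theta function θ₂(z, q). -/
def theta2 (z q : ℂ) : ℂ :=
  2 * ∑' n : ℕ, q ^ (((n : ℂ) + 1 / 2) ^ 2) * Complex.cos ((2 * (n : ℂ) + 1) * z)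

/-- Jacobi theta function θ₃(z, q). -/
def theta3 (z q : ℂ) : ℂ :=
  1 + 2 * ∑' n : ℕ, q ^ ((n + 1) ^ 2) * Complex.cos (2 * ((n : ℂ) + 1) * z)

/-- Jacobi theta function θ₄(z, q). -/
def theta4 (z q : ℂ) : ℂ :=
  1 + 2 * ∑' n : ℕ, (-1 : ℂ) ^ (n + 1) * q ^ ((n + 1) ^ 2) *
    Complex.cos (2 * ((n : ℂ) + 1) * z)

/-- Jacobian elliptic function sn(z | m) with complex argument and parameter,
defined through quotients of Jacobi theta functions with nome
`q = exp (-π K(1-m)/K(m))` (so that `sn (K m * u) m` corresponds to the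
theta quotient at `π u / 2`). -/
def sn (z m : ℂ) : ℂ :=
  (theta3 0 (nome m) / theta2 0 (nome m)) *
    (theta1 ((Real.pi : ℂ) * z / (2 * ellK m)) (nome m) /
      theta4 ((Real.pi : ℂ) * z / (2 * ellK m)) (nome m))

/-- Jacobian elliptic function cn(z | m). -/
def cn (z m : ℂ) : ℂ :=
  (theta4 0 (nome m) / theta2 0 (nome m)) *
    (theta2 ((Real.pi : ℂ) * z / (2 * ellK m)) (nome m) /
      theta4 ((Real.pi : ℂ) * z / (2 * ellK m)) (nome m))

/-- Jacobian elliptic function dn(z | m). -/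
def dn (z m : ℂ) : ℂ :=
  (theta4 0 (nome m) / theta3 0 (nome m)) *
    (theta3 ((Real.pi : ℂ) * z / (2 * ellK m)) (nome m) /
      theta4 ((Real.pi : ℂ) * z / (2 * ellK m)) (nome m))

/-- The lattice ratio τ = i K(1-m)/K(m). -/
def tauC (m : ℂ) : ℂ := Complex.I * ellK (1 - m) / ellK m

/-- Subsidiary Jacobian elliptic function sc = sn/cn. -/
def sc (z m : ℂ) : ℂ := sn z m / cn z m

/-- Subsidiary Jacobian elliptic function nc = 1/cn. -/
def nc (z m : ℂ) : ℂ := 1 / cn z m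

/-- Subsidiary Jacobian elliptic function dc = dn/cn. -/
def dcC (z m : ℂ) : ℂ := dn z m / cn z m

/-- The branch cut [1, ∞) on the real axis. -/
def cut : Set ℂ := {z : ℂ | z.im = 0 ∧ 1 ≤ z.re}

/-- Real complete elliptic integral of the first kind (for real parameter `m < 1`
the complex integral is real-valued). -/
def KR (m : ℝ) : ℝ := (ellK (m : ℂ)).re

/-- Classical real Jacobian elliptic function sn(x | m). -/
def snR (x m : ℝ) : ℝ := (sn (x : ℂ) (m : ℂ)).re

/-- Classical real Jacobian elliptic function cn(x | m). -/
def cnR (x m : ℝ) : ℝ := (cn (x : ℂ) (m : ℂ)).re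

/-- Classical real Jacobian elliptic function dn(x | m). -/
def dnR (x m : ℝ) : ℝ := (dn (x : ℂ) (m : ℂ)).re

/-- φ(u, μ) = dc²(K(1-μ)u | 1-μ) − dc²(K(μ)u | μ) with real dc = dn/cn. -/
def phi (u μ : ℝ) : ℝ :=
  (dnR (KR (1 - μ) * u) (1 - μ) / cnR (KR (1 - μ) * u) (1 - μ)) ^ 2 -
    (dnR (KR μ * u) μ / cnR (KR μ * u) μ) ^ 2

/-- The square of the continuously extended modulus |sn(K(m)u | m)|² for `m > 1`,
given by μ(s²d₁² + c²d²s₁²c₁²)/(1 − d²s₁²)² with μ = 1/m, μ₁ = 1 − μ. -/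
def snAbsSq (u m : ℝ) : ℝ :=
  let μ := 1 / m
  let μ₁ := 1 - μ
  let s := snR (KR μ * u) μ
  let c := cnR (KR μ * u) μ
  let d := dnR (KR μ * u) μ
  let s₁ := snR (KR μ₁ * u) μ₁
  let c₁ := cnR (KR μ₁ * u) μ₁
  let d₁ := dnR (KR μ₁ * u) μ₁
  μ * (s ^ 2 * d₁ ^ 2 + c ^ 2 * d ^ 2 * s₁ ^ 2 * c₁ ^ 2) / (1 - d ^ 2 * s₁ ^ 2) ^ 2

open HurwitzZeta Topology in
lemma cosKernel_pos' (a : ℝ) {r : ℝ} (hr : 0 < r) : 0 < cosKernel a r := by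
  have h := evenKernel_functional_equation (a : UnitAddCircle) (1 / r)
  rw [one_div_one_div] at h
  have hE : 0 < evenKernel (a : UnitAddCircle) (1 / r) := by
    have hs := hasSum_int_evenKernel a (t := 1 / r) (by positivity)
    rw [← hs.tsum_eq]
    exact hs.summable.tsum_pos (fun n => (Real.exp_pos _).le) 0 (Real.exp_pos _)
  rw [h] at hE
  exact pos_of_mul_pos_right hE (by positivity)

open HurwitzZeta in
lemma cosKernel_eq' (a : ℝ) {r : ℝ} (hr : 0 < r) :
    cosKernel a r = (r ^ (1/2 : ℝ))⁻¹ * evenKernel a (1 / r) := by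
  have h := evenKernel_functional_equation (a : UnitAddCircle) (1 / r)
  rw [one_div_one_div] at h
  rw [h, Real.div_rpow zero_le_one hr.le, Real.one_rpow]
  have : r ^ (1/2 : ℝ) ≠ 0 := by positivity
  field_simp

lemma summable_int_exp {c : ℝ} (hc : 0 < c) :
    Summable (fun n : ℤ => Real.exp (-c * |(n : ℝ)|)) := by
  have h : Summable (fun n : ℕ => Real.exp (n * (-c))) :=
    Real.summable_exp_nat_mul_iff.mpr (by linarith)
  apply Summable.of_nat_of_neg <;>
  · refine h.congr fun n => ?_
    simp [mul_comm]

open HurwitzZeta Topology in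
lemma evenKernel_lim (a : ℝ) (ha0 : 0 ≤ a) (ha : a < 1/2) :
    Tendsto (fun t : ℝ => evenKernel a t * Real.exp (Real.pi * a ^ 2 * t)) atTop (𝓝 1) := by
  have hpi := Real.pi_pos
  have key : ∀ n : ℤ, (1 - 2 * a) * |(n : ℝ)| ≤ (n : ℝ) ^ 2 + 2 * n * a := by
    intro n
    have h1 : |(n : ℝ)| ≤ (n : ℝ) ^ 2 := by
      have : |n| ≤ n ^ 2 := by
        rw [← sq_abs]; exact Int.le_self_sq _
      exact_mod_cast this
    have h2 : -|(n : ℝ)| ≤ n := neg_abs_le _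
    nlinarith
  have hs : ∀ t : ℝ, 0 < t → evenKernel a t * Real.exp (Real.pi * a ^ 2 * t) =
      ∑' n : ℤ, Real.exp (-(Real.pi * ((n : ℝ) ^ 2 + 2 * n * a)) * t) := by
    intro t ht
    rw [← ((hasSum_int_evenKernel a ht).mul_right _).tsum_eq]
    refine tsum_congr fun n => ?_
    rw [← Real.exp_add]; ring_nf
  have hlim : (1 : ℝ) = ∑' n : ℤ, (if n = 0 then (1:ℝ) else 0) := by simp
  refine Tendsto.congr' (f₁ := fun t : ℝ => ∑' n : ℤ,
      Real.exp (-(Real.pi * ((n : ℝ) ^ 2 + 2 * n * a)) * t)) ?_ ?_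
  · filter_upwards [eventually_gt_atTop 0] with t ht using (hs t ht).symm
  rw [hlim]
  refine tendsto_tsum_of_dominated_convergence
    (bound := fun n : ℤ => Real.exp (-(Real.pi * (1 - 2 * a)) * |(n : ℝ)|))
    (summable_int_exp (by apply mul_pos hpi; linarith)) ?_ ?_
  · intro n
    by_cases hn : n = 0
    · subst hn; simp
    · rw [if_neg hn]
      have hp : 0 < Real.pi * ((n : ℝ) ^ 2 + 2 * n * a) := by
        apply mul_pos hpi
        refine lt_of_lt_of_le ?_ (key n)
        have : 0 < |(n : ℝ)| := by positivity
        exact mul_pos (by linarith) this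
      refine Real.tendsto_exp_atBot.comp ?_
      exact tendsto_id.const_mul_atTop_of_neg (by linarith)
  · filter_upwards [eventually_ge_atTop 1] with t ht n
    rw [Real.norm_of_nonneg (Real.exp_pos _).le]
    apply Real.exp_le_exp.mpr
    have h1 := key n
    have h0 : 0 ≤ (1 - 2 * a) * |(n : ℝ)| := mul_nonneg (by linarith) (abs_nonneg _)
    have h2 : (1 - 2 * a) * |(n : ℝ)| ≤ ((n : ℝ) ^ 2 + 2 * n * a) * t := by nlinarith
    have := mul_le_mul_of_nonneg_left h2 hpi.le
    nlinarith

open HurwitzZeta Topology in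
lemma cosKernel_lim (a : ℝ) :
    Tendsto (fun t : ℝ => (cosKernel a t - 1) * Real.exp (Real.pi * t)) atTop
      (𝓝 (2 * Real.cos (2 * Real.pi * a))) := by
  have hpi := Real.pi_pos
  have hs : ∀ t : ℝ, 0 < t → (cosKernel a t - 1) * Real.exp (Real.pi * t) =
      ∑' n : ℕ, 2 * Real.cos (2 * Real.pi * a * (n + 1)) *
        Real.exp (-(Real.pi * ((n : ℝ) ^ 2 + 2 * n)) * t) := by
    intro t ht
    rw [← ((hasSum_nat_cosKernel₀ a ht).mul_right _).tsum_eq]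
    refine tsum_congr fun n => ?_
    rw [mul_assoc, ← Real.exp_add]; ring_nf
  have hlim : 2 * Real.cos (2 * Real.pi * a) =
      ∑' n : ℕ, (if n = 0 then 2 * Real.cos (2 * Real.pi * a) else 0) := by simp
  rw [hlim]
  refine Tendsto.congr' (f₁ := fun t : ℝ => ∑' n : ℕ, 2 * Real.cos (2 * Real.pi * a * (n + 1)) *
        Real.exp (-(Real.pi * ((n : ℝ) ^ 2 + 2 * n)) * t)) ?_ ?_
  · filter_upwards [eventually_gt_atTop 0] with t ht using (hs t ht).symm
  refine tendsto_tsum_of_dominated_convergence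
    (bound := fun n : ℕ => 2 * Real.exp (n * (-Real.pi)))
    ((Real.summable_exp_nat_mul_iff.mpr (by linarith)).mul_left 2) ?_ ?_
  · intro n
    by_cases hn : n = 0
    · subst hn; simp
    · rw [if_neg hn]
      have hp : 0 < Real.pi * ((n : ℝ) ^ 2 + 2 * n) := by positivity
      rw [show (0:ℝ) = 2 * Real.cos (2 * Real.pi * a * (n + 1)) * 0 by simp]
      refine Tendsto.const_mul _ (Real.tendsto_exp_atBot.comp ?_)
      exact tendsto_id.const_mul_atTop_of_neg (by linarith)
  · filter_upwards [eventually_ge_atTop 1] with t ht n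
    rw [norm_mul, norm_mul, Real.norm_of_nonneg (Real.exp_pos _).le]
    have hc : ‖Real.cos (2 * Real.pi * a * (n + 1))‖ ≤ 1 := Real.abs_cos_le_one _
    have he : Real.exp (-(Real.pi * ((n : ℝ) ^ 2 + 2 * n)) * t) ≤ Real.exp (n * (-Real.pi)) := by
      apply Real.exp_le_exp.mpr
      have hn : (0:ℝ) ≤ n := Nat.cast_nonneg n
      have : (n:ℝ) ≤ ((n : ℝ) ^ 2 + 2 * n) * t := by nlinarith [sq_nonneg (n:ℝ)]
      nlinarith
    rw [Real.norm_of_nonneg (by norm_num : (0:ℝ) ≤ 2)]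
    calc _ ≤ 2 * 1 * Real.exp (n * (-Real.pi)) := by gcongr
      _ = _ := by ring

/-- real theta functions via cosine kernels -/
def T3 (u r : ℝ) : ℝ := HurwitzZeta.cosKernel ((u / 2 : ℝ) : UnitAddCircle) r

def T4 (u r : ℝ) : ℝ := HurwitzZeta.cosKernel ((u / 2 + 1 / 2 : ℝ) : UnitAddCircle) r

def T2 (u r : ℝ) : ℝ :=
  HurwitzZeta.cosKernel ((u / 4 : ℝ) : UnitAddCircle) (r / 4) -
    HurwitzZeta.cosKernel ((u / 2 : ℝ) : UnitAddCircle) r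

def DD (u r : ℝ) : ℝ := T2 0 r * T3 u r / (T3 0 r * T2 u r)

open HurwitzZeta in
lemma theta3_eq (u : ℝ) {r : ℝ} (hr : 0 < r) :
    theta3 ((Real.pi * u / 2 : ℝ) : ℂ) (Complex.exp ((-(Real.pi * r) : ℝ) : ℂ)) = (T3 u r : ℂ) := by
  have h := hasSum_nat_cosKernel₀ (u / 2) hr
  have h2 : (T3 u r : ℂ) = 1 + ((cosKernel ((u / 2 : ℝ) : UnitAddCircle) r - 1 : ℝ) : ℂ) := by
    simp [T3]
  rw [h2, ← h.tsum_eq, theta3, Complex.ofReal_tsum, ← tsum_mul_left]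
  congr 1
  refine tsum_congr fun n => ?_
  rw [← Complex.exp_nat_mul]
  push_cast
  rw [mul_comm (Complex.exp _), ← mul_assoc]
  congr 2 <;> [congr 1; skip] <;> ring_nf

open HurwitzZeta in
lemma theta4_eq (u : ℝ) {r : ℝ} (hr : 0 < r) :
    theta4 ((Real.pi * u / 2 : ℝ) : ℂ) (Complex.exp ((-(Real.pi * r) : ℝ) : ℂ)) = (T4 u r : ℂ) := by
  have h := hasSum_nat_cosKernel₀ (u / 2 + 1 / 2) hr
  have h2 : (T4 u r : ℂ) =
      1 + ((cosKernel ((u / 2 + 1 / 2 : ℝ) : UnitAddCircle) r - 1 : ℝ) : ℂ) := by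
    simp [T4]
  rw [h2, ← h.tsum_eq, theta4, Complex.ofReal_tsum, ← tsum_mul_left]
  congr 1
  refine tsum_congr fun n => ?_
  rw [← Complex.exp_nat_mul]
  have hc : Real.cos (2 * Real.pi * (u / 2 + 1 / 2) * (n + 1)) =
      (-1) ^ (n + 1) * Real.cos (Real.pi * u * (n + 1)) := by
    rw [← Real.cos_add_nat_mul_pi]
    congr 1; push_cast; ring
  rw [hc]
  push_cast
  rw [show (2 * ((n : ℂ) + 1) * (Real.pi * u / 2)) = Real.pi * u * (n + 1) by ring,
    show ((n : ℂ) + 1) ^ 2 * -(Real.pi * r) = -Real.pi * (n + 1) ^ 2 * r by ring]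
  ring

open HurwitzZeta in
lemma theta2_eq (u : ℝ) {r : ℝ} (hr : 0 < r) :
    theta2 ((Real.pi * u / 2 : ℝ) : ℂ) (Complex.exp ((-(Real.pi * r) : ℝ) : ℂ)) = (T2 u r : ℂ) := by
  have h := hasSum_nat_cosKernel₀ (u / 4) (t := r / 4) (by positivity)
  have h3 := hasSum_nat_cosKernel₀ (u / 2) hr
  obtain ⟨f, hf⟩ : ∃ f : ℕ → ℝ, ∀ n : ℕ, f n = 2 * Real.cos (2 * Real.pi * (u / 4) * (n + 1)) *
      Real.exp (-Real.pi * (n + 1) ^ 2 * (r / 4)) := ⟨_, fun _ => rfl⟩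
  replace h : HasSum f (cosKernel ((u / 4 : ℝ) : UnitAddCircle) (r / 4) - 1) := h.congr_fun hf
  have hE : Summable (fun n : ℕ => f (2 * n)) :=
    h.summable.comp_injective (i := fun n : ℕ => 2 * n) (fun a b hab => by simpa using hab)
  have hO : HasSum (fun n : ℕ => f (2 * n + 1))
      (cosKernel ((u / 2 : ℝ) : UnitAddCircle) r - 1) := by
    refine h3.congr_fun fun n => ?_
    rw [hf]
    push_cast
    rw [show 2 * Real.pi * (u / 4) * (2 * (n : ℝ) + 1 + 1) = 2 * Real.pi * (u / 2) * (n + 1) by ring,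
      show -Real.pi * (2 * (n : ℝ) + 1 + 1) ^ 2 * (r / 4) = -Real.pi * (n + 1) ^ 2 * r by ring]
  have hu := (hE.hasSum.even_add_odd hO).unique h
  have h2 : T2 u r = ∑' n : ℕ, f (2 * n) := by
    rw [T2]; linarith
  rw [h2, theta2, Complex.ofReal_tsum, ← tsum_mul_left]
  refine tsum_congr fun n => ?_
  rw [hf, Complex.cpow_def_of_ne_zero (Complex.exp_ne_zero _), ← Complex.ofReal_exp,
    ← Complex.ofReal_log (Real.exp_pos _).le, Real.log_exp]
  push_cast
  rw [show 2 * (Real.pi : ℂ) * (u / 4) * (2 * (n : ℂ) + 1) = (2 * n + 1) * (Real.pi * u / 2) by ring,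
    show -(Real.pi : ℂ) * (2 * (n : ℂ) + 1) ^ 2 * (r / 4) = -(Real.pi * r) * (n + 1 / 2) ^ 2 by ring]
  ring

open Topology in
lemma DD_top (u : ℝ) (hu : u ∈ Set.Ioo (0 : ℝ) 1) :
    Tendsto (DD u) atTop (𝓝 (1 / Real.cos (Real.pi * u / 2))) := by
  have hpi := Real.pi_pos
  have hc : 0 < Real.cos (Real.pi * u / 2) :=
    Real.cos_pos_of_mem_Ioo ⟨by nlinarith [hu.1], by nlinarith [hu.2]⟩
  have hexp : ∀ c : ℝ, 0 < c → Tendsto (fun r : ℝ => Real.exp (-c * r)) atTop (𝓝 0) := by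
    intro c hc
    exact Real.tendsto_exp_atBot.comp (tendsto_id.const_mul_atTop_of_neg (by linarith))
  have h3 : ∀ v : ℝ, Tendsto (T3 v) atTop (𝓝 1) := by
    intro v
    have := ((cosKernel_lim (v / 2)).mul (hexp _ hpi)).add_const 1
    rw [mul_zero, zero_add] at this
    refine this.congr fun r => ?_
    rw [mul_assoc, ← Real.exp_add, T3]; ring_nf; simp
  have h2 : ∀ v : ℝ, Tendsto (fun r => T2 v r * Real.exp (Real.pi * r / 4)) atTop
      (𝓝 (2 * Real.cos (Real.pi * v / 2))) := by
    intro v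
    have h1 := (cosKernel_lim (v / 4)).comp (tendsto_id.atTop_div_const (by norm_num : (0:ℝ) < 4))
    have h2 := (cosKernel_lim (v / 2)).mul (hexp (3 * Real.pi / 4) (by positivity))
    have := h1.sub h2
    rw [mul_zero, sub_zero, show 2 * Real.pi * (v / 4) = Real.pi * v / 2 by ring] at this
    refine this.congr fun r => ?_
    simp only [Function.comp, id]
    rw [mul_assoc, ← Real.exp_add, T2]; ring_nf
  have h20 := h2 0
  have hfin := (h20.mul (h3 u)).div ((h3 0).mul (h2 u)) (by positivity)
  have e : 2 * Real.cos (Real.pi * 0 / 2) * 1 / (1 * (2 * Real.cos (Real.pi * u / 2))) =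
      1 / Real.cos (Real.pi * u / 2) := by
    simp; field_simp
  rw [e] at hfin
  refine hfin.congr fun r => ?_
  have := (Real.exp_pos (Real.pi * r / 4)).ne'
  simp only [DD, Pi.div_apply]
  rw [show T2 0 r * Real.exp (Real.pi * r / 4) * T3 u r =
      T2 0 r * T3 u r * Real.exp (Real.pi * r / 4) by ring, ← mul_assoc,
      mul_div_mul_right _ _ this]

open Topology HurwitzZeta in
lemma DD_zero (u : ℝ) (hu : u ∈ Set.Ioo (0 : ℝ) 1) :
    Tendsto (DD u) (𝓝[>] 0) (𝓝 1) := by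
  have hpi := Real.pi_pos
  have hinv : Tendsto (fun r : ℝ => 1 / r) (𝓝[>] 0) atTop := by
    simpa using tendsto_inv_nhdsGT_zero (𝕜 := ℝ)
  let w : ℝ → ℝ → ℝ := fun v r => r ^ (1/2 : ℝ) * Real.exp (Real.pi * (v/2) ^ 2 * (1 / r))
  have hw : ∀ v r, 0 < r → w v r ≠ 0 := fun v r hr => by positivity
  have h3 : ∀ v : ℝ, 0 ≤ v → v < 1 → Tendsto (fun r => T3 v r * w v r) (𝓝[>] 0) (𝓝 1) := by
    intro v h0 h1
    refine ((evenKernel_lim (v / 2) (by linarith) (by linarith)).comp hinv).congr' ?_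
    filter_upwards [self_mem_nhdsWithin] with r hr
    have hr : 0 < r := hr
    have : r ^ (1/2 : ℝ) ≠ 0 := by positivity
    simp only [Function.comp, T3, w, cosKernel_eq' _ hr]
    field_simp
  have h2 : ∀ v : ℝ, 0 ≤ v → v < 1 → Tendsto (fun r => T2 v r * w v r) (𝓝[>] 0) (𝓝 1) := by
    intro v h0 h1
    have h4 := (evenKernel_lim (v / 4) (by linarith) (by linarith)).comp
      (hinv.const_mul_atTop (by norm_num : (0:ℝ) < 4))
    have := (h4.const_mul 2).sub (h3 v h0 h1)
    rw [show (2:ℝ) * 1 - 1 = 1 by norm_num] at this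
    refine this.congr' ?_
    filter_upwards [self_mem_nhdsWithin] with r hr
    have hr : 0 < r := hr
    have hne : r ^ (1/2 : ℝ) ≠ 0 := by positivity
    have h4 : (r / 4) ^ (1/2 : ℝ) = r ^ (1/2 : ℝ) / 2 := by
      rw [Real.div_rpow hr.le (by norm_num)]
      congr 1
      rw [show (4:ℝ) = 2 ^ (2:ℝ) by norm_num, ← Real.rpow_mul (by norm_num)]; norm_num
    have e1 : 1 / (r / 4) = 4 * (1 / r) := by field_simp
    have e2 : Real.pi * (v / 4) ^ 2 * (4 * (1 / r)) = Real.pi * (v/2) ^ 2 * (1 / r) := by ring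
    simp only [Function.comp, T2, T3, w]
    rw [cosKernel_eq' (v / 4) (show 0 < r / 4 by positivity), h4, e1, e2, sub_mul]
    congr 1
    field_simp
  have hfin := ((h2 0 le_rfl one_pos).mul (h3 u hu.1.le hu.2)).div
    ((h3 0 le_rfl one_pos).mul (h2 u hu.1.le hu.2)) (by norm_num)
  rw [show (1:ℝ) * 1 / (1 * 1) = 1 by norm_num] at hfin
  refine hfin.congr' ?_
  filter_upwards [self_mem_nhdsWithin] with r hr
  have a1 := hw 0 r hr
  have a2 := hw u r hr
  simp only [DD, Pi.div_apply]
  rw [show T2 0 r * w 0 r * (T3 u r * w u r) = T2 0 r * T3 u r * (w 0 r * w u r) by ring,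
    show T3 0 r * w 0 r * (T2 u r * w u r) = T3 0 r * T2 u r * (w 0 r * w u r) by ring,
    mul_div_mul_right _ _ (mul_ne_zero a1 a2)]

/-- real integrand -/
def kf (m t : ℝ) : ℝ := 1 / Real.sqrt ((1 - t ^ 2) * (1 - m * t ^ 2))

lemma ellK_eq {m : ℝ} (hm1 : m < 1) :
    ellK (m : ℂ) = ((∫ t in (0:ℝ)..1, kf m t : ℝ) : ℂ) := by
  rw [ellK, ← intervalIntegral.integral_ofReal]
  refine intervalIntegral.integral_congr fun t ht => ?_
  rw [Set.uIcc_of_le zero_le_one] at ht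
  have h1 : 0 ≤ 1 - t ^ 2 := by nlinarith [ht.1, ht.2]
  have h2 : 0 ≤ 1 - m * t ^ 2 := by nlinarith [ht.1, ht.2, sq_nonneg t]
  simp only [kf, Real.sqrt_eq_rpow]
  push_cast [Complex.ofReal_cpow (mul_nonneg h1 h2)]
  rfl

lemma ellK_KR {m : ℝ} (hm1 : m < 1) : ellK (m : ℂ) = (KR m : ℂ) := by
  rw [KR, ellK_eq hm1, Complex.ofReal_re]

lemma KR_eq {m : ℝ} (hm1 : m < 1) : KR m = ∫ t in (0:ℝ)..1, kf m t := by
  rw [KR, ellK_eq hm1, Complex.ofReal_re]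

lemma kf_bound {m t : ℝ} (hm0 : 0 ≤ m) (hm1 : m < 1) (ht0 : 0 ≤ t) (ht1 : t < 1) :
    kf m t ≤ (1 - t) ^ (-(1/2) : ℝ) * (1 / Real.sqrt (1 - m)) := by
  rw [Real.rpow_neg (by linarith), ← Real.sqrt_eq_rpow, kf, ← one_div, one_div_mul_one_div,
    ← Real.sqrt_mul (by linarith)]
  apply one_div_le_one_div_of_le
  · apply Real.sqrt_pos.mpr; apply mul_pos <;> linarith
  · apply Real.sqrt_le_sqrt
    have h1 : t ^ 2 ≤ 1 := by nlinarith
    have h2 : m * t ^ 2 ≤ m * 1 := mul_le_mul_of_nonneg_left h1 hm0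
    apply mul_le_mul <;> nlinarith

lemma int_bound (m : ℝ) : IntervalIntegrable
    (fun t : ℝ => (1 - t) ^ (-(1/2) : ℝ) * (1 / Real.sqrt (1 - m))) MeasureTheory.volume 0 1 := by
  have h := (intervalIntegral.intervalIntegrable_rpow' (a := 1) (b := 0)
    (r := -(1/2)) (by norm_num)).comp_sub_left 1
  simp only [sub_self, sub_zero] at h
  exact h.mul_const _

lemma kf_int {m : ℝ} (hm0 : 0 ≤ m) (hm1 : m < 1) :
    IntervalIntegrable (kf m) MeasureTheory.volume 0 1 := by
  refine (int_bound m).mono_fun' ?_ ?_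
  · apply Measurable.aestronglyMeasurable
    unfold kf
    fun_prop
  · rw [Set.uIoc_of_le zero_le_one, ← MeasureTheory.restrict_Ioo_eq_restrict_Ioc]
    filter_upwards [MeasureTheory.ae_restrict_mem measurableSet_Ioo] with t ht
    rw [Real.norm_of_nonneg (by unfold kf; positivity)]
    exact kf_bound hm0 hm1 ht.1.le ht.2

lemma KR_le {m : ℝ} (hm0 : 0 ≤ m) (hm1 : m ≤ 1/2) :
    KR m ≤ ∫ t in (0:ℝ)..1, (1 - t) ^ (-(1/2) : ℝ) * (1 / Real.sqrt (1 - 1/2)) := by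
  rw [KR_eq (by linarith)]
  refine intervalIntegral.integral_mono_on_of_le_Ioo zero_le_one (kf_int hm0 (by linarith))
    (int_bound _) fun t ht => ?_
  refine (kf_bound hm0 (by linarith) ht.1.le ht.2).trans ?_
  have : 0 ≤ (1 - t) ^ (-(1/2) : ℝ) := Real.rpow_nonneg (by linarith [ht.2]) _
  refine mul_le_mul_of_nonneg_left ?_ this
  apply one_div_le_one_div_of_le
  · apply Real.sqrt_pos.mpr; norm_num
  · apply Real.sqrt_le_sqrt; linarith

lemma KR_pos {m : ℝ} (hm0 : 0 ≤ m) (hm1 : m < 1) : 0 < KR m := by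
  have h : ∫ t in (0:ℝ)..1, (1:ℝ) ≤ ∫ t in (0:ℝ)..1, kf m t := by
    refine intervalIntegral.integral_mono_on_of_le_Ioo zero_le_one (by simp)
      (kf_int hm0 hm1) fun t ht => ?_
    have h1 : 0 < 1 - t ^ 2 := by nlinarith [ht.1, ht.2]
    have h2 : 0 < 1 - m * t ^ 2 := by nlinarith [ht.1, ht.2, sq_nonneg t]
    rw [kf, le_div_iff₀ (Real.sqrt_pos.mpr (mul_pos h1 h2)), one_mul]
    apply Real.sqrt_le_one.mpr
    have : 0 ≤ m * t ^ 2 := by positivity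
    nlinarith [sq_nonneg t]
  rw [KR_eq hm1]
  simp at h
  linarith

lemma KR_ge {m : ℝ} (hm0 : 0 < m) (hm1 : m < 1) : -Real.log (1 - m) / 2 ≤ KR m := by
  have hd : ∀ t ∈ Set.uIcc (0:ℝ) 1, HasDerivAt (fun t => -Real.log (1 - m * t) / 2 / m)
      (1 / (2 * (1 - m * t))) t := by
    intro t ht
    rw [Set.uIcc_of_le zero_le_one] at ht
    have h2 : 0 < 1 - m * t := by nlinarith [ht.1, ht.2]
    have := ((((((hasDerivAt_id t).const_mul m).const_sub 1).log h2.ne').neg).div_const 2).div_const m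
    refine this.congr_deriv ?_
    simp only [id]
    field_simp
  have hci : IntervalIntegrable (fun t => 1 / (2 * (1 - m * t))) MeasureTheory.volume 0 1 := by
    apply ContinuousOn.intervalIntegrable
    intro t ht
    rw [Set.uIcc_of_le zero_le_one] at ht
    have h2 : 0 < 1 - m * t := by nlinarith [ht.1, ht.2]
    apply ContinuousAt.continuousWithinAt
    exact ContinuousAt.div (by fun_prop) (by fun_prop) (by positivity)
  have hF := intervalIntegral.integral_eq_sub_of_hasDerivAt hd hci
  have h : ∫ t in (0:ℝ)..1, 1 / (2 * (1 - m * t)) ≤ ∫ t in (0:ℝ)..1, kf m t := by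
    refine intervalIntegral.integral_mono_on_of_le_Ioo zero_le_one hci
      (kf_int hm0.le hm1) fun t ht => ?_
    have h1 : 0 < 1 - t ^ 2 := by nlinarith [ht.1, ht.2]
    have h2 : 0 < 1 - m * t ^ 2 := by nlinarith [ht.1, ht.2, sq_nonneg t]
    rw [kf]
    apply one_div_le_one_div_of_le (Real.sqrt_pos.mpr (mul_pos h1 h2))
    have h3 : 1 - m * t ^ 2 ≤ 2 * (1 - m * t) := by nlinarith [mul_nonneg hm0.le (sq_nonneg (1 - t))]
    refine le_trans ?_ h3
    rw [Real.sqrt_le_left h2.le, sq (1 - m * t ^ 2)]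
    apply mul_le_mul_of_nonneg_right _ h2.le
    nlinarith [sq_nonneg t]
  rw [KR_eq hm1]
  refine le_trans ?_ h
  rw [hF]
  have hl : Real.log (1 - m) ≤ 0 := Real.log_nonpos (by linarith) (by linarith)
  simp only [mul_one, mul_zero, sub_zero, Real.log_one, neg_zero, zero_div]
  rw [le_div_iff₀ hm0]
  nlinarith

lemma dc_eq (u : ℝ) {m : ℝ} (hm0 : 0 < m) (hm1 : m < 1) :
    dnR (KR m * u) m / cnR (KR m * u) m = DD u (KR (1 - m) / KR m) := by
  have hK := KR_pos hm0.le hm1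
  have hK' := KR_pos (m := 1 - m) (by linarith) (by linarith)
  set r := KR (1 - m) / KR m with hr
  have hr0 : 0 < r := by positivity
  have hKc : (KR m : ℂ) ≠ 0 := by exact_mod_cast hK.ne'
  have hn : nome (m : ℂ) = Complex.exp ((-(Real.pi * r) : ℝ) : ℂ) := by
    have e : (1 : ℂ) - (m : ℂ) = ((1 - m : ℝ) : ℂ) := by push_cast; rfl
    rw [nome, e, ellK_KR hm1, ellK_KR (by linarith), hr]
    congr 1
    push_cast
    ring
  have hz : (Real.pi : ℂ) * ((KR m * u : ℝ) : ℂ) / (2 * ellK (m : ℂ)) =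
      ((Real.pi * u / 2 : ℝ) : ℂ) := by
    rw [ellK_KR hm1]; push_cast; field_simp
  have h0 : (0 : ℂ) = ((Real.pi * 0 / 2 : ℝ) : ℂ) := by simp
  have h4 : T4 u r ≠ 0 := (cosKernel_pos' _ hr0).ne'
  have h40 : T4 0 r ≠ 0 := (cosKernel_pos' _ hr0).ne'
  rw [dnR, cnR, dn, cn, hn, hz, h0]
  simp only [theta2_eq _ hr0, theta3_eq _ hr0, theta4_eq _ hr0]
  norm_cast
  rw [DD]
  field_simp

/-- For `u ∈ (0,1)`, `φ(u,μ) → tan²(πu/2)` as `μ → 1−`. -/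
theorem phi_tendsto_tan_sq (u : ℝ) (hu : u ∈ Set.Ioo (0 : ℝ) 1) :
    Filter.Tendsto (phi u) (nhdsWithin 1 (Set.Iio 1))
      (nhds ((Real.tan (Real.pi * u / 2)) ^ 2)) := by
  have hpi := Real.pi_pos
  have hc : 0 < Real.cos (Real.pi * u / 2) :=
    Real.cos_pos_of_mem_Ioo ⟨by nlinarith [hu.1], by nlinarith [hu.2]⟩
  have hnear : ∀ᶠ μ : ℝ in nhdsWithin 1 (Set.Iio 1), 1/2 < μ ∧ μ < 1 := by
    filter_upwards [Ioo_mem_nhdsLT (show (1/2 : ℝ) < 1 by norm_num)] with μ h using h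
  have hsub : Tendsto (fun μ : ℝ => 1 - μ) (nhdsWithin 1 (Set.Iio 1)) (nhdsWithin 0 (Set.Ioi 0)) := by
    rw [tendsto_nhdsWithin_iff]
    constructor
    · have : Tendsto (fun μ : ℝ => 1 - μ) (nhds 1) (nhds (1 - 1)) := by
        apply Continuous.tendsto; fun_prop
      rw [sub_self] at this
      exact this.mono_left nhdsWithin_le_nhds
    · filter_upwards [hnear] with μ h
      exact sub_pos.mpr h.2
  have hlog : Tendsto (fun μ : ℝ => -Real.log (1 - μ) / 2) (nhdsWithin 1 (Set.Iio 1)) atTop :=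
    (tendsto_neg_atBot_atTop.comp (Real.tendsto_log_nhdsGT_zero.comp hsub)).atTop_div_const
      (by norm_num)
  have hKtop : Tendsto KR (nhdsWithin 1 (Set.Iio 1)) atTop := by
    refine tendsto_atTop_mono' _ ?_ hlog
    filter_upwards [hnear] with μ h using KR_ge (by linarith [h.1]) h.2
  have hr : Tendsto (fun μ => KR (1 - μ) / KR μ) (nhdsWithin 1 (Set.Iio 1))
      (nhdsWithin 0 (Set.Ioi 0)) := by
    rw [tendsto_nhdsWithin_iff]
    constructor
    · refine squeeze_zero' ?_ ?_ (hKtop.const_div_atTop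
        (∫ t in (0:ℝ)..1, (1 - t) ^ (-(1/2) : ℝ) * (1 / Real.sqrt (1 - 1/2))))
      · filter_upwards [hnear] with μ h
        exact (div_pos (KR_pos (by linarith) (by linarith)) (KR_pos (by linarith) h.2)).le
      · filter_upwards [hnear] with μ h
        exact div_le_div_of_nonneg_right (KR_le (by linarith) (by linarith))
          (KR_pos (by linarith) h.2).le
    · filter_upwards [hnear] with μ h
      exact div_pos (KR_pos (by linarith) (by linarith)) (KR_pos (by linarith) h.2)
  have hr' : Tendsto (fun μ => KR μ / KR (1 - μ)) (nhdsWithin 1 (Set.Iio 1)) atTop := by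
    refine (tendsto_inv_nhdsGT_zero.comp hr).congr fun μ => ?_
    simp
  have h1 := ((DD_top u hu).comp hr').pow 2
  have h2 := ((DD_zero u hu).comp hr).pow 2
  have h := h1.sub h2
  have e : (1 / Real.cos (Real.pi * u / 2)) ^ 2 - 1 ^ 2 = Real.tan (Real.pi * u / 2) ^ 2 := by
    rw [Real.tan_eq_sin_div_cos, div_pow, div_pow, Real.sin_sq]
    field_simp
  rw [e] at h
  refine h.congr' ?_
  filter_upwards [hnear] with μ hμ
  have a := dc_eq u (m := 1 - μ) (by linarith) (by linarith)
  rw [sub_sub_cancel] at a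
  rw [phi, a, dc_eq u (by linarith) hμ.2]
  rfl
end
end

section
/- For every pair (u,m) with either u ∈ (0,1/2] and m ∈ (1,∞), or u ∈ (0,1) and m ∈ [2,∞), one has |sn(K(m)u | m)| < 1, where |sn(K(m)u | m)| denotes the continuous extension of the modulus to the cut (1,∞); explicitly, writing μ = 1/m, μ₁ = 1 − μ, s = sn(K(μ)u|μ), s₁ = sn(K(μ₁)u|μ₁), c, c₁, d, d₁ analogously, this modulus satisfies |sn(K(m)u|m)|² = μ·(s²d₁² + c²d²s₁²c₁²)/(1 − d²s₁²)². -/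
noncomputable section

open Complex Filter Set Asymptotics

/-- Normalised theta function `θ₂` in the two-variable form. -/
def jH (z τ : ℂ) : ℂ :=
  cexp (Real.pi * I * τ / 4 + Real.pi * I * z) * jacobiTheta₂ (z + τ / 2) τ

lemma jT_mul_aux (x y τ : ℂ) (hτ : 0 < τ.im) :
    jacobiTheta₂ (x + y) τ * jacobiTheta₂ (x - y) τ =
      jacobiTheta₂ (2 * x) (2 * τ) * jacobiTheta₂ (2 * y) (2 * τ) +
      jH (2 * x) (2 * τ) * jH (2 * y) (2 * τ) := by
  have h2 : 0 < (2 * τ).im := by simpa using hτ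
  have s1 := fun z => (summable_jacobiTheta₂_term_iff z τ).mpr hτ
  have s2 := fun z => (summable_jacobiTheta₂_term_iff z (2 * τ)).mpr h2
  let e : (ℤ × ℤ) ⊕ (ℤ × ℤ) → ℤ × ℤ :=
    Sum.elim (fun p => (p.1 + p.2, p.1 - p.2)) (fun p => (p.1 + p.2 + 1, p.1 - p.2))
  have he : Function.Bijective e := by
    constructor
    · rintro (⟨a, b⟩ | ⟨a, b⟩) (⟨c, d⟩ | ⟨c, d⟩) h <;>
        simp only [e, Sum.elim_inl, Sum.elim_inr, Prod.mk.injEq] at h <;> obtain ⟨h1, h2⟩ := h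
      · congr 2 <;> omega
      · omega
      · omega
      · congr 2 <;> omega
    · rintro ⟨m, n⟩
      rcases Int.even_or_odd' (m + n) with ⟨k, hk | hk⟩
      · refine ⟨Sum.inl (k, m - k), ?_⟩
        simp only [e, Sum.elim_inl, Prod.mk.injEq]
        constructor <;> omega
      · refine ⟨Sum.inr (k, m - k - 1), ?_⟩
        simp only [e, Sum.elim_inr, Prod.mk.injEq]
        constructor <;> omega
  let F : ℤ × ℤ → ℂ := fun p =>
    jacobiTheta₂_term p.1 (x + y) τ * jacobiTheta₂_term p.2 (x - y) τ
  have hL : HasSum F (jacobiTheta₂ (x + y) τ * jacobiTheta₂ (x - y) τ) := by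
    have := tsum_mul_tsum_of_summable_norm (s1 (x + y)).norm (s1 (x - y)).norm
    rw [jacobiTheta₂, jacobiTheta₂, this]
    exact (summable_mul_of_summable_norm (s1 (x + y)).norm (s1 (x - y)).norm).hasSum
  have hA : HasSum ((F ∘ e) ∘ Sum.inl)
      (jacobiTheta₂ (2 * x) (2 * τ) * jacobiTheta₂ (2 * y) (2 * τ)) := by
    have := tsum_mul_tsum_of_summable_norm (s2 (2 * x)).norm (s2 (2 * y)).norm
    rw [jacobiTheta₂, jacobiTheta₂, this]
    convert! (summable_mul_of_summable_norm (s2 (2 * x)).norm (s2 (2 * y)).norm).hasSum using 1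
    funext ⟨a, b⟩
    simp only [F, e, Function.comp, Sum.elim_inl, jacobiTheta₂_term, ← Complex.exp_add]
    congr 1
    push_cast
    ring
  have hB : HasSum ((F ∘ e) ∘ Sum.inr) (jH (2 * x) (2 * τ) * jH (2 * y) (2 * τ)) := by
    have := tsum_mul_tsum_of_summable_norm (s2 (2 * x + 2 * τ / 2)).norm
      (s2 (2 * y + 2 * τ / 2)).norm
    rw [jH, jH, mul_mul_mul_comm, jacobiTheta₂, jacobiTheta₂, this]
    convert! (summable_mul_of_summable_norm (s2 (2 * x + 2 * τ / 2)).norm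
      (s2 (2 * y + 2 * τ / 2)).norm).hasSum.mul_left _ using 1
    funext ⟨a, b⟩
    simp only [F, e, Function.comp, Sum.elim_inr, jacobiTheta₂_term, ← Complex.exp_add]
    congr 1
    push_cast
    ring
  have hS := HasSum.sum hA hB
  exact (((Equiv.ofBijective e he).hasSum_iff (f := F)).mpr hL).unique hS

lemma jH_add_one (z τ : ℂ) : jH (z + 1) τ = - jH z τ := by
  rw [jH, jH, show z + 1 + τ / 2 = z + τ / 2 + 1 by ring, jacobiTheta₂_add_left,
    show (Real.pi * I * τ / 4 + Real.pi * I * (z + 1) : ℂ)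
      = (Real.pi * I * τ / 4 + Real.pi * I * z) + Real.pi * I by ring, Complex.exp_add _ (Real.pi * I),
    Complex.exp_pi_mul_I]
  ring

lemma jH_neg (z τ : ℂ) : jH (-z) τ = jH z τ := by
  have := jacobiTheta₂_add_left' (-z - τ / 2) τ
  rw [show -z - τ / 2 + τ = -z + τ / 2 by ring, show -z - τ / 2 = -(z + τ / 2) by ring,
    jacobiTheta₂_neg_left] at this
  rw [jH, jH, this, ← mul_assoc, ← Complex.exp_add]
  congr 2
  ring

lemma jH_half (τ : ℂ) : jH (1 / 2) τ = 0 := by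
  have h := jH_add_one (-(1/2)) τ
  rw [jH_neg, show (-(1/2) + 1 : ℂ) = 1/2 by ring] at h
  linear_combination h / 2

/-- product formula for `θ₂`. -/
lemma jH_mul_aux (x y τ : ℂ) (hτ : 0 < τ.im) :
    jH (x + y) τ * jH (x - y) τ =
      jH (2 * x) (2 * τ) * jacobiTheta₂ (2 * y) (2 * τ) +
      jacobiTheta₂ (2 * x) (2 * τ) * jH (2 * y) (2 * τ) := by
  have h := jT_mul_aux (x + τ / 2) y τ hτ
  have h2 := jacobiTheta₂_add_left' (2 * x) (2 * τ)
  have e1 : jH (2 * (x + τ / 2)) (2 * τ) =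
      cexp (-(Real.pi * I * τ / 2 + 2 * Real.pi * I * x)) * jacobiTheta₂ (2 * x) (2 * τ) := by
    rw [jH, show 2 * (x + τ / 2) + 2 * τ / 2 = 2 * x + 2 * τ by ring, h2, ← mul_assoc,
      ← Complex.exp_add]
    congr 2
    ring
  have e2 : jacobiTheta₂ (2 * (x + τ / 2)) (2 * τ) =
      cexp (-(Real.pi * I * τ / 2 + 2 * Real.pi * I * x)) * jH (2 * x) (2 * τ) := by
    rw [jH, ← mul_assoc, ← Complex.exp_add,
      show -(Real.pi * I * τ / 2 + 2 * Real.pi * I * x) +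
        (Real.pi * I * (2 * τ) / 4 + Real.pi * I * (2 * x)) = 0 by ring, Complex.exp_zero, one_mul]
    congr 1
    ring
  rw [e1, e2] at h
  have e3 : jH (x + y) τ * jH (x - y) τ = cexp (Real.pi * I * τ / 2 + 2 * Real.pi * I * x) *
      (jacobiTheta₂ (x + τ / 2 + y) τ * jacobiTheta₂ (x + τ / 2 - y) τ) := by
    rw [jH, jH, mul_mul_mul_comm, ← Complex.exp_add]
    congr 2
    · ring_nf
    · ring_nf
    · ring_nf
  have e4 : cexp (Real.pi * I * τ / 2 + 2 * Real.pi * I * x) *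
      cexp (-(Real.pi * I * τ / 2 + 2 * Real.pi * I * x)) = 1 := by
    rw [← Complex.exp_add, add_neg_cancel, Complex.exp_zero]
  rw [e3, h]
  linear_combination (jH (2 * x) (2 * τ) * jacobiTheta₂ (2 * y) (2 * τ) +
      jacobiTheta₂ (2 * x) (2 * τ) * jH (2 * y) (2 * τ)) * e4

/-- Modular transformation of `θ₂`. -/
lemma jH_functional (z τ : ℂ) (hτ : τ ≠ 0) : jH z τ =
    1 / (-I * τ) ^ (1 / 2 : ℂ) * cexp (-Real.pi * I * z ^ 2 / τ) *
      jacobiTheta₂ (z / τ + 1 / 2) (-1 / τ) := by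
  rw [jH, jacobiTheta₂_functional_equation, show (z + τ / 2) / τ = z / τ + 1 / 2 by field_simp,
    ← mul_assoc]
  congr 1
  rw [mul_left_comm, ← Complex.exp_add]
  congr 2
  field_simp
  ring

/-- Modular transformation of `θ₁`. -/
lemma jH1_functional (z τ : ℂ) (hτ : τ ≠ 0) : jH (z - 1 / 2) τ =
    I / (-I * τ) ^ (1 / 2 : ℂ) * cexp (-Real.pi * I * z ^ 2 / τ) *
      jH (z / τ - 1 / 2) (-1 / τ) := by
  rw [jH_functional _ _ hτ, jH]
  have e : jacobiTheta₂ (z / τ - 1 / 2 + -1 / τ / 2) (-1 / τ) =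
      jacobiTheta₂ ((z - 1 / 2) / τ + 1 / 2) (-1 / τ) := by
    rw [← jacobiTheta₂_add_left]
    congr 1
    field_simp
    ring
  rw [e, ← mul_assoc]
  congr 1
  rw [mul_assoc (I / _), ← Complex.exp_add, div_eq_mul_one_div I, mul_comm I, mul_assoc (1 / _)]
  congr 1
  have : I = cexp (Real.pi / 2 * I) := by rw [Complex.exp_pi_div_two_mul_I]
  conv_rhs => rw [show ∀ w, I * w = cexp (Real.pi / 2 * I) * w by intro w; rw [← this]]
  rw [← Complex.exp_add]
  congr 1
  field_simp
  ring

lemma jT_differentiable (τ : ℂ) (hτ : 0 < τ.im) : Differentiable ℂ (fun z => jacobiTheta₂ z τ) :=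
  fun z => differentiableAt_jacobiTheta₂_fst z hτ

lemma jH_differentiable (τ : ℂ) (hτ : 0 < τ.im) : Differentiable ℂ (fun z => jH z τ) := by
  unfold jH
  have := jT_differentiable τ hτ
  have h2 : Differentiable ℂ (fun z => jacobiTheta₂ (z + τ / 2) τ) :=
    this.comp (f := fun z => z + τ / 2) (by fun_prop)
  fun_prop

lemma jT_conj (x t : ℝ) :
    (starRingEnd ℂ) (jacobiTheta₂ x (t * I)) = jacobiTheta₂ x (t * I) := by
  rw [jacobiTheta₂_conj]; simp

lemma jH_conj (x t : ℝ) : (starRingEnd ℂ) (jH x (t * I)) = jH x (t * I) := by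
  conv_rhs => rw [← jH_neg]
  rw [jH, map_mul, jacobiTheta₂_conj, ← Complex.exp_conj, jH]
  simp only [map_add, map_mul, map_div₀, conj_ofReal, conj_I, map_ofNat]
  congr 1
  · congr 1
    ring
  · rw [← jacobiTheta₂_neg_left]
    congr 1 <;> ring

def r3 (t x : ℝ) : ℝ := (jacobiTheta₂ x (t * I)).re
def r2 (t x : ℝ) : ℝ := (jH x (t * I)).re
def r1 (t x : ℝ) : ℝ := r2 t (x - 1 / 2)
def r4 (t x : ℝ) : ℝ := r3 t (x + 1 / 2)

lemma r3_coe (t x : ℝ) : (r3 t x : ℂ) = jacobiTheta₂ x (t * I) :=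
  Complex.conj_eq_iff_re.mp (jT_conj x t)

lemma r2_coe (t x : ℝ) : (r2 t x : ℂ) = jH x (t * I) :=
  Complex.conj_eq_iff_re.mp (jH_conj x t)

lemma im_tI {t : ℝ} (ht : 0 < t) : 0 < ((t : ℂ) * I).im := by simpa using ht

lemma r3_mul {t : ℝ} (ht : 0 < t) (x y : ℝ) : r3 t (x + y) * r3 t (x - y) =
    r3 (2 * t) (2 * x) * r3 (2 * t) (2 * y) + r2 (2 * t) (2 * x) * r2 (2 * t) (2 * y) := by
  have := jT_mul_aux x y (t * I) (im_tI ht)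
  apply Complex.ofReal_injective
  push_cast
  simp only [r3_coe, r2_coe]
  push_cast
  rw [this, mul_assoc]

lemma r2_mul {t : ℝ} (ht : 0 < t) (x y : ℝ) : r2 t (x + y) * r2 t (x - y) =
    r2 (2 * t) (2 * x) * r3 (2 * t) (2 * y) + r3 (2 * t) (2 * x) * r2 (2 * t) (2 * y) := by
  have := jH_mul_aux x y (t * I) (im_tI ht)
  apply Complex.ofReal_injective
  push_cast
  simp only [r3_coe, r2_coe]
  push_cast
  rw [this, mul_assoc]

lemma r3_add_one (t x : ℝ) : r3 t (x + 1) = r3 t x := by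
  simp only [r3]; push_cast; rw [jacobiTheta₂_add_left]

lemma r2_add_one (t x : ℝ) : r2 t (x + 1) = - r2 t x := by
  simp only [r2]; push_cast; rw [jH_add_one, neg_re]

lemma r3_neg (t x : ℝ) : r3 t (-x) = r3 t x := by
  simp only [r3]; push_cast; rw [jacobiTheta₂_neg_left]

lemma r2_neg (t x : ℝ) : r2 t (-x) = r2 t x := by
  simp only [r2]; push_cast; rw [jH_neg]

lemma r2_half (t : ℝ) : r2 t (1 / 2) = 0 := by
  have h := r2_add_one t (-(1/2))
  rw [r2_neg, show (-(1/2) + 1 : ℝ) = 1/2 by ring] at h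
  linarith

lemma sqrt_aux {t : ℝ} (ht : 0 < t) : (-I * (t * I)) ^ (1 / 2 : ℂ) = (Real.sqrt t : ℂ) := by
  rw [show -I * (t * I) = (t : ℂ) by linear_combination (-(t:ℂ)) * I_mul_I, Real.sqrt_eq_rpow,
    Complex.ofReal_cpow ht.le]
  norm_num

lemma tau_aux {t : ℝ} (ht : 0 < t) : (-1 / (t * I) : ℂ) = ((1 / t : ℝ) : ℂ) * I := by
  have : (t : ℂ) ≠ 0 := by exact_mod_cast ht.ne'
  push_cast
  field_simp
  simp

lemma tI_ne {t : ℝ} (ht : 0 < t) : (t * I : ℂ) ≠ 0 := by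
  simp [ht.ne']

lemma r3_pos {t : ℝ} (ht : 0 < t) (x : ℝ) : 0 < r3 t x := by
  have hc : (t : ℂ) ≠ 0 := by exact_mod_cast ht.ne'
  have h := jacobiTheta₂_functional_equation x (t * I)
  rw [sqrt_aux ht, tau_aux ht] at h
  have him : 0 < (((1 / t : ℝ) : ℂ) * I).im := im_tI (by positivity)
  have hs := hasSum_jacobiTheta₂_term (x / (t * I)) him
  have hterm : ∀ n : ℤ, jacobiTheta₂_term n (x / (t * I)) (((1 / t : ℝ) : ℂ) * I) =
      ((Real.exp (2 * Real.pi * n * x / t - Real.pi * n ^ 2 / t) : ℝ) : ℂ) := by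
    intro n
    rw [jacobiTheta₂_term]
    push_cast
    congr 1
    field_simp
    linear_combination (n : ℂ) ^ 2 * I_sq
  simp only [hterm] at hs
  have hs' := Complex.hasSum_re hs
  simp only [Complex.ofReal_re] at hs'
  have hpos : 0 < (jacobiTheta₂ (x / (t * I)) (((1 / t : ℝ) : ℂ) * I)).re := by
    rw [← hs'.tsum_eq]
    exact hs'.summable.tsum_pos (fun n => (Real.exp_pos _).le) 0 (Real.exp_pos _)
  have hr : 1 / ((Real.sqrt t : ℝ) : ℂ) * cexp (-Real.pi * I * x ^ 2 / (t * I)) =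
      ((1 / Real.sqrt t * Real.exp (-Real.pi * x ^ 2 / t) : ℝ) : ℂ) := by
    push_cast
    congr 2
    field_simp
  rw [hr] at h
  rw [r3, h, Complex.re_ofReal_mul]
  have := Real.sqrt_pos.mpr ht
  positivity

lemma r2_zero {t : ℝ} (ht : 0 < t) : r2 t 0 = 1 / Real.sqrt t * r4 (1 / t) 0 := by
  have h := jH_functional 0 (t * I) (tI_ne ht)
  rw [sqrt_aux ht, tau_aux ht] at h
  apply Complex.ofReal_injective
  rw [r4, r2_coe]
  push_cast
  rw [h, r3_coe]
  simp

lemma r4_zero {t : ℝ} (ht : 0 < t) : r4 t 0 = 1 / Real.sqrt t * r2 (1 / t) 0 := by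
  rw [r2_zero (by positivity : 0 < 1 / t), one_div_one_div, Real.sqrt_div (by norm_num),
    Real.sqrt_one]
  have := (Real.sqrt_pos.mpr ht).ne'
  field_simp

lemma r3_zero {t : ℝ} (ht : 0 < t) : r3 t 0 = 1 / Real.sqrt t * r3 (1 / t) 0 := by
  have h := jacobiTheta₂_functional_equation 0 (t * I)
  rw [sqrt_aux ht, tau_aux ht] at h
  apply Complex.ofReal_injective
  push_cast
  rw [r3_coe, r3_coe]
  push_cast
  push_cast at h
  rw [h]
  simp

lemma r4_pos {t : ℝ} (ht : 0 < t) (x : ℝ) : 0 < r4 t x := r3_pos ht _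

lemma r2_zero_pos {t : ℝ} (ht : 0 < t) : 0 < r2 t 0 := by
  rw [r2_zero ht]
  have := Real.sqrt_pos.mpr ht
  have := r4_pos (by positivity : 0 < 1 / t) 0
  positivity

lemma r3_differentiable {t : ℝ} (ht : 0 < t) : Differentiable ℝ (r3 t) := fun x =>
  (((jT_differentiable (t * I) (im_tI ht)) x).hasDerivAt.real_of_complex).differentiableAt

lemma r2_differentiable {t : ℝ} (ht : 0 < t) : Differentiable ℝ (r2 t) := fun x =>
  (((jH_differentiable (t * I) (im_tI ht)) x).hasDerivAt.real_of_complex).differentiableAt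

lemma r1_differentiable {t : ℝ} (ht : 0 < t) : Differentiable ℝ (r1 t) := by
  unfold r1
  exact (r2_differentiable ht).comp (f := fun x => x - 1 / 2) (by fun_prop)

lemma r4_differentiable {t : ℝ} (ht : 0 < t) : Differentiable ℝ (r4 t) := by
  unfold r4
  exact (r3_differentiable ht).comp (f := fun x => x + 1 / 2) (by fun_prop)

lemma r1_deriv_zero {t : ℝ} (ht : 0 < t) :
    deriv (r1 t) 0 = 1 / (Real.sqrt t * t) * deriv (r1 (1 / t)) 0 := by
  have hc : (t : ℂ) ≠ 0 := by exact_mod_cast ht.ne'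
  have key : ∀ s : ℝ, 0 < s → Differentiable ℂ (fun z => jH (z - 1 / 2) (s * I)) := fun s hs =>
    (jH_differentiable (s * I) (im_tI hs)).comp (f := fun z => z - 1 / 2) (by fun_prop)
  have hre : ∀ s : ℝ, 0 < s → deriv (r1 s) 0 =
      (deriv (fun z : ℂ => jH (z - 1 / 2) (s * I)) 0).re := by
    intro s hs
    have h0 : HasDerivAt (fun z : ℂ => jH (z - 1 / 2) (s * I))
      (deriv (fun z : ℂ => jH (z - 1 / 2) (s * I)) 0) ((0 : ℝ) : ℂ) := by
      rw [Complex.ofReal_zero]; exact (key s hs 0).hasDerivAt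
    have := h0.real_of_complex
    rw [← this.deriv]
    congr 1
    funext x
    simp [r1, r2]
  have h1 : 0 < 1 / t := by positivity
  rw [hre t ht, hre _ h1]
  have hf : (fun z : ℂ => jH (z - 1 / 2) (t * I)) = fun z =>
      I / (Real.sqrt t : ℂ) * cexp (-Real.pi * I * z ^ 2 / (t * I)) *
        (fun w => jH (w - 1 / 2) (((1 / t : ℝ) : ℂ) * I)) (z / (t * I)) := by
    funext z
    rw [jH1_functional _ _ (tI_ne ht), sqrt_aux ht, tau_aux ht]
  have hg : HasDerivAt (fun w => jH (w - 1 / 2) (((1 / t : ℝ) : ℂ) * I))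
    (deriv (fun w => jH (w - 1 / 2) (((1 / t : ℝ) : ℂ) * I)) 0) ((0 : ℂ) / (t * I)) := by
    rw [zero_div]; exact (key _ h1 0).hasDerivAt
  have hg2 := HasDerivAt.comp (0 : ℂ) hg ((hasDerivAt_id (0 : ℂ)).div_const (t * I))
  have he : HasDerivAt (fun z : ℂ => I / (Real.sqrt t : ℂ) * cexp (-Real.pi * I * z ^ 2 / (t * I)))
      (I / (Real.sqrt t : ℂ) * (cexp (-Real.pi * I * 0 ^ 2 / (t * I)) *
        (-Real.pi * I * (2 * 0 ^ (2 - 1) * 1) / (t * I)))) 0 := by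
    exact ((((hasDerivAt_id (0 : ℂ)).pow 2).const_mul _).div_const _).cexp.const_mul _
  have hd := he.mul hg2
  rw [hf]
  have hs : ((Real.sqrt t : ℝ) : ℂ) ≠ 0 := by exact_mod_cast (Real.sqrt_pos.mpr ht).ne'
  have := hd.deriv
  erw [this]
  rw [← Complex.re_ofReal_mul]
  congr 1
  generalize deriv (fun w => jH (w - 1 / 2) (((1 / t : ℝ) : ℂ) * I)) 0 = G
  push_cast
  simp
  field_simp
  rw [I_sq]
  ring

lemma q_cpow (t : ℝ) (s : ℂ) :
    (cexp (-(Real.pi : ℂ) * t)) ^ s = cexp (-(Real.pi : ℂ) * t * s) := by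
  rw [Complex.cpow_def_of_ne_zero (Complex.exp_ne_zero _), Complex.log_exp]
  · simp [Real.pi_pos]
  · simp [Real.pi_pos.le]

lemma theta3_eq_s17 {t : ℝ} (ht : 0 < t) (x : ℝ) :
    theta3 ((Real.pi : ℂ) * x) (cexp (-(Real.pi : ℂ) * t)) = r3 t x := by
  have hs := (hasSum_jacobiTheta₂_term (x : ℂ) (im_tI ht)).nat_add_neg
  rw [← hasSum_nat_add_iff' 1] at hs
  have he : ∀ n : ℕ, jacobiTheta₂_term ((n + 1 : ℕ) : ℤ) x (t * I) +
      jacobiTheta₂_term (-((n + 1 : ℕ) : ℤ)) x (t * I) =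
      2 * (cexp (-(Real.pi : ℂ) * t) ^ ((n + 1) ^ 2) *
        Complex.cos (2 * ((n : ℂ) + 1) * ((Real.pi : ℂ) * x))) := by
    intro n
    rw [jacobiTheta₂_term, jacobiTheta₂_term, Complex.cos, ← Complex.exp_nat_mul]
    rw [show ∀ a b c : ℂ, 2 * (a * ((b + c) / 2)) = a * b + a * c by intros; ring,
      ← Complex.exp_add, ← Complex.exp_add]
    push_cast
    congr 2 <;> linear_combination (Real.pi : ℂ) * t * (n + 1) ^ 2 * I_sq
  simp only [he] at hs
  have h0 : jacobiTheta₂_term 0 x (t * I) = 1 := by simp [jacobiTheta₂_term]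
  simp [h0] at hs
  simp only [← neg_mul] at hs
  rw [theta3, ← tsum_mul_left, hs.tsum_eq, r3_coe]
  ring

lemma theta2_hasSum {t : ℝ} (ht : 0 < t) (x : ℝ) :
    HasSum (fun n : ℕ => 2 * (cexp (-(Real.pi : ℂ) * t) ^ (((n : ℂ) + 1 / 2) ^ 2) *
      Complex.cos ((2 * (n : ℂ) + 1) * ((Real.pi : ℂ) * x)))) (r2 t x : ℂ) := by
  have hs := ((hasSum_jacobiTheta₂_term (x + t * I / 2 : ℂ) (im_tI ht)).mul_left
    (cexp (Real.pi * I * (t * I) / 4 + Real.pi * I * x))).nat_add_neg_add_one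
  rw [r2_coe, jH]
  convert! hs using 1
  funext n
  rw [jacobiTheta₂_term, jacobiTheta₂_term, Complex.cos, q_cpow]
  rw [show ∀ a b c : ℂ, 2 * (a * ((b + c) / 2)) = a * b + a * c by intros; ring]
  simp only [← Complex.exp_add]
  push_cast
  congr 2 <;> linear_combination -(Real.pi : ℂ) * t * (n + 1 / 2) ^ 2 * I_sq

lemma theta2_eq_s17 {t : ℝ} (ht : 0 < t) (x : ℝ) :
    theta2 ((Real.pi : ℂ) * x) (cexp (-(Real.pi : ℂ) * t)) = r2 t x := by
  rw [theta2, ← tsum_mul_left, (theta2_hasSum ht x).tsum_eq]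

lemma theta1_term (t x : ℝ) (n : ℕ) :
    cexp (-(Real.pi : ℂ) * t) ^ (((n : ℂ) + 1 / 2) ^ 2) *
      Complex.cos ((2 * (n : ℂ) + 1) * ((Real.pi : ℂ) * ((x - 1 / 2 : ℝ) : ℂ))) =
    (-1 : ℂ) ^ n * cexp (-(Real.pi : ℂ) * t) ^ (((n : ℂ) + 1 / 2) ^ 2) *
    Complex.sin ((2 * (n : ℂ) + 1) * ((Real.pi : ℂ) * x)) := by
  push_cast
  rw [show (2 * (n : ℂ) + 1) * ((Real.pi : ℂ) * (x - 1 / 2)) =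
    ((2 * (n : ℂ) + 1) * ((Real.pi : ℂ) * x) - n * Real.pi) - Real.pi / 2 by ring,
    Complex.cos_sub_pi_div_two, Complex.sin_antiperiodic.sub_nat_mul_eq]
  ring

lemma theta1_eq {t : ℝ} (ht : 0 < t) (x : ℝ) :
    theta1 ((Real.pi : ℂ) * x) (cexp (-(Real.pi : ℂ) * t)) = r1 t x := by
  rw [r1, ← theta2_eq_s17 ht, theta2, theta1]
  simp only [theta1_term]

lemma theta4_eq_s17 {t : ℝ} (ht : 0 < t) (x : ℝ) :
    theta4 ((Real.pi : ℂ) * x) (cexp (-(Real.pi : ℂ) * t)) = r4 t x := by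
  rw [r4, ← theta3_eq_s17 ht, theta3, theta4]
  congr 2
  refine tsum_congr fun n => ?_
  push_cast
  rw [show 2 * ((n : ℂ) + 1) * ((Real.pi : ℂ) * (x + 1 / 2)) =
    2 * ((n : ℂ) + 1) * ((Real.pi : ℂ) * x) + ((n + 1 : ℕ) : ℂ) * Real.pi by push_cast; ring,
    Complex.cos_antiperiodic.add_nat_mul_eq]
  ring

lemma abs_sin_odd (n : ℕ) (y : ℝ) : |Real.sin (n * y)| ≤ n * |Real.sin y| := by
  induction n with
  | zero => simp
  | succ n ih =>
    push_cast
    rw [add_mul, Real.sin_add, one_mul]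
    calc _ ≤ |Real.sin (n * y) * Real.cos y| + |Real.cos (n * y) * Real.sin y| := abs_add_le _ _
      _ ≤ |Real.sin (n * y)| * 1 + 1 * |Real.sin y| := by
        rw [abs_mul, abs_mul]
        gcongr
        · exact Real.abs_cos_le_one _
        · exact Real.abs_cos_le_one _
      _ ≤ _ := by linarith

lemma r1_hasSum {t : ℝ} (ht : 0 < t) (x : ℝ) :
    HasSum (fun n : ℕ => 2 * ((-1) ^ n * Real.exp (-Real.pi * t * ((n : ℝ) + 1 / 2) ^ 2) *
      Real.sin ((2 * (n : ℝ) + 1) * (Real.pi * x)))) (r1 t x) := by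
  have := theta2_hasSum ht (x - 1 / 2)
  simp only [theta1_term] at this
  simp only [q_cpow] at this
  rw [← Complex.hasSum_ofReal]
  convert! this using 1
  funext n
  push_cast
  rfl

lemma r1_pos_large {t : ℝ} (ht : 1 ≤ t) {x : ℝ} (hx : x ∈ Ioo (0 : ℝ) 1) : 0 < r1 t x := by
  have h := r1_hasSum (by linarith : 0 < t) x
  have hsin : 0 < Real.sin (Real.pi * x) := by
    apply Real.sin_pos_of_pos_of_lt_pi
    · have := hx.1; have := Real.pi_pos; positivity
    · have := hx.2; have := Real.pi_pos; nlinarith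
  set q := Real.exp (-Real.pi * t) with hq
  have hq0 : 0 < q := Real.exp_pos _
  have hq1 : q < 1 / 4 := by
    have h3 := Real.pi_gt_three
    have h1 : q ≤ Real.exp (-3) := by
      rw [hq]; apply Real.exp_le_exp.mpr; nlinarith
    have h2 : Real.exp (-3) * Real.exp 3 = 1 := by rw [← Real.exp_add]; simp
    have h4 : (3 : ℝ) + 1 < Real.exp 3 := Real.add_one_lt_exp (by norm_num)
    have := Real.exp_pos (-3)
    nlinarith
  set A := 2 * Real.exp (-Real.pi * t * (1 / 4)) * Real.sin (Real.pi * x) with hA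
  have hA0 : 0 < A := by have := Real.exp_pos (-Real.pi * t * (1 / 4)); positivity
  -- tail bound
  rw [← hasSum_nat_add_iff' 1] at h
  have hgeo : HasSum (fun n : ℕ => A * ((3 * q ^ 2) * (3 * q ^ 2) ^ n))
      (A * ((3 * q ^ 2) * (1 - 3 * q ^ 2)⁻¹)) := by
    refine ((hasSum_geometric_of_lt_one (by positivity) ?_).mul_left _).mul_left _
    nlinarith
  have hb : ∀ n : ℕ, ‖2 * ((-1) ^ (n + 1) * Real.exp (-Real.pi * t * (((n + 1 : ℕ) : ℝ) + 1 / 2) ^ 2) *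
      Real.sin ((2 * ((n + 1 : ℕ) : ℝ) + 1) * (Real.pi * x)))‖ ≤
      A * ((3 * q ^ 2) * (3 * q ^ 2) ^ n) := by
    intro n
    have e1 : Real.exp (-Real.pi * t * (((n + 1 : ℕ) : ℝ) + 1 / 2) ^ 2) =
        Real.exp (-Real.pi * t * (1 / 4)) * q ^ ((n + 1) * (n + 2)) := by
      rw [hq, ← Real.exp_nat_mul, ← Real.exp_add]
      congr 1; push_cast; ring
    have e2 : q ^ ((n + 1) * (n + 2)) ≤ q ^ (2 * (n + 1)) :=
      pow_le_pow_of_le_one hq0.le (by linarith) (by nlinarith)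
    have e3 : ((2 * (n + 1) + 1 : ℕ) : ℝ) ≤ 3 ^ (n + 1) := by
      have := one_add_mul_le_pow (show (-2 : ℝ) ≤ 2 by norm_num) (n + 1)
      push_cast at *
      norm_num at this
      linarith
    have e4 := abs_sin_odd (2 * (n + 1) + 1) (Real.pi * x)
    rw [abs_of_pos hsin] at e4
    have e5 : |Real.sin ((2 * ((n + 1 : ℕ) : ℝ) + 1) * (Real.pi * x))| ≤
        3 ^ (n + 1) * Real.sin (Real.pi * x) := by
      refine le_trans (le_of_eq ?_) (e4.trans (mul_le_mul_of_nonneg_right e3 hsin.le))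
      push_cast; rfl
    rw [e1, Real.norm_eq_abs, abs_mul, abs_mul, abs_mul, abs_mul, abs_pow, abs_neg, abs_one,
      one_pow, one_mul, abs_two, abs_of_pos (Real.exp_pos _), abs_of_pos (pow_pos hq0 _)]
    calc _ ≤ 2 * (Real.exp (-Real.pi * t * (1 / 4)) * q ^ (2 * (n + 1)) *
          (3 ^ (n + 1) * Real.sin (Real.pi * x))) := by gcongr
      _ = _ := by rw [hA, pow_mul, ← pow_succ' (3 * q ^ 2), mul_pow 3]; ring
  have hle := h.tsum_eq ▸ tsum_of_norm_bounded hgeo hb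
  simp at hle
  have e0 : 2 * (Real.exp (-(Real.pi * t * (2 ^ 2)⁻¹)) * Real.sin (Real.pi * x)) = A := by
    rw [hA, ← mul_assoc]; congr 3; ring
  rw [e0] at hle
  have h2 : 3 * q ^ 2 * (1 - 3 * q ^ 2)⁻¹ < 1 := by
    have : 3 * q ^ 2 < 1 / 4 := by nlinarith
    rw [← div_eq_mul_inv, div_lt_one (by linarith)]
    linarith
  have h3 := (abs_le.mp hle).1
  nlinarith

lemma r1_one_sub (t x : ℝ) : r1 t (1 - x) = r1 t x := by
  rw [r1, r1, ← r2_neg]; congr 1; ring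

lemma r1_mul_r2 {t : ℝ} (ht : 0 < t) (x y : ℝ) : r1 t (x + y) * r2 t (x - y) =
    r1 (2 * t) (2 * x) * r4 (2 * t) (2 * y) + r4 (2 * t) (2 * x) * r1 (2 * t) (2 * y) := by
  have h := r2_mul ht (x - 1 / 4) (y - 1 / 4)
  have p : ∀ z, r4 (2 * t) z = r3 (2 * t) (z - 1 / 2) := by
    intro z; rw [r4, ← r3_add_one _ (z - 1 / 2)]; congr 1; ring
  rw [r1, r1, r1, p, p]
  convert h using 2 <;> ring_nf

lemma r2_eq_r1 (t x : ℝ) : r2 t x = r1 t (1 / 2 - x) := by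
  rw [r1, ← r2_neg]; congr 1; ring

lemma r1_zero (t : ℝ) : r1 t 0 = 0 := by
  rw [r1, zero_sub, r2_neg, r2_half]

lemma r1_ne_zero_step {t : ℝ} (ht : 0 < t) (h : ∀ x ∈ Ioo (0 : ℝ) 1, r1 (2 * t) x ≠ 0) :
    ∀ x ∈ Ioo (0 : ℝ) 1, r1 t x ≠ 0 := by
  have main : ∀ x ∈ Ioc (0 : ℝ) (1 / 2), r1 t x ≠ 0 := by
    intro x hx h0
    rcases eq_or_lt_of_le hx.2 with h1 | h1
    · rw [h1, r1, sub_self] at h0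
      exact (r2_zero_pos ht).ne' h0
    · have := r1_mul_r2 ht x 0
      rw [add_zero, h0, mul_zero, r1_zero, mul_zero, add_zero, zero_mul] at this
      have h3 := h (2 * x) ⟨by linarith [hx.1], by linarith⟩
      exact mul_ne_zero h3 (r4_pos (by linarith : 0 < 2 * t) 0).ne' this.symm
  intro x hx
  rcases le_or_gt x (1 / 2) with h1 | h1
  · exact main x ⟨hx.1, h1⟩
  · rw [← r1_one_sub]
    exact main _ ⟨by linarith [hx.2], by linarith⟩

lemma r1_ne_zero {t : ℝ} (ht : 0 < t) : ∀ x ∈ Ioo (0 : ℝ) 1, r1 t x ≠ 0 := by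
  have : ∀ n : ℕ, ∀ t : ℝ, 0 < t → 1 ≤ 2 ^ n * t → ∀ x ∈ Ioo (0 : ℝ) 1, r1 t x ≠ 0 := by
    intro n
    induction n with
    | zero => intro t _ h x hx; exact (r1_pos_large (by simpa using h) hx).ne'
    | succ n ih =>
      intro t h0 h
      exact r1_ne_zero_step h0 (ih (2 * t) (by linarith) (by rw [pow_succ] at h; linarith))
  obtain ⟨n, hn⟩ := pow_unbounded_of_one_lt (1 / t) (one_lt_two)
  refine this n t ht ?_
  rw [div_lt_iff₀ ht] at hn
  exact hn.le

lemma r1_pos {t : ℝ} (ht : 0 < t) {x : ℝ} (hx : x ∈ Ioo (0 : ℝ) 1) : 0 < r1 t x := by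
  by_contra hn
  have hc : ContinuousOn (r1 t) (uIcc x (1 / 2)) := (r1_differentiable ht).continuous.continuousOn
  have h2 : 0 < r1 t (1 / 2) := by rw [r1, sub_self]; exact r2_zero_pos ht
  have := intermediate_value_uIcc hc
  obtain ⟨y, hy, hy0⟩ := this (show (0 : ℝ) ∈ uIcc (r1 t x) (r1 t (1 / 2)) by
    rw [mem_uIcc]; left; exact ⟨not_lt.mp hn, h2.le⟩)
  refine r1_ne_zero ht y ?_ hy0
  rw [mem_uIcc] at hy
  have h1 := hx.1
  have h2 := hx.2
  rcases hy with h | h <;> constructor <;> linarith [h.1, h.2]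

lemma r2_pos {t : ℝ} (ht : 0 < t) {x : ℝ} (hx : x ∈ Ioo (-(1 / 2) : ℝ) (1 / 2)) : 0 < r2 t x := by
  rw [r2_eq_r1]
  exact r1_pos ht ⟨by linarith [hx.2], by linarith [hx.1]⟩

def eS (t x : ℝ) : ℝ := (r3 t 0 / r2 t 0) * (r1 t x / r4 t x)
def eC (t x : ℝ) : ℝ := (r4 t 0 / r2 t 0) * (r2 t x / r4 t x)
def eD (t x : ℝ) : ℝ := (r4 t 0 / r3 t 0) * (r3 t x / r4 t x)
def elam (t : ℝ) : ℝ := (r2 t 0 / r3 t 0) ^ 4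
def eE (t : ℝ) : ℝ := deriv (r1 t) 0 * r3 t 0 / (r2 t 0 * r4 t 0)

lemma r3_sq {t : ℝ} (ht : 0 < t) (x : ℝ) : r3 t x ^ 2 =
    r3 (2 * t) (2 * x) * r3 (2 * t) 0 + r2 (2 * t) (2 * x) * r2 (2 * t) 0 := by
  have := r3_mul ht x 0
  simpa [sq] using this

lemma r2_sq {t : ℝ} (ht : 0 < t) (x : ℝ) : r2 t x ^ 2 =
    r2 (2 * t) (2 * x) * r3 (2 * t) 0 + r3 (2 * t) (2 * x) * r2 (2 * t) 0 := by
  have := r2_mul ht x 0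
  simpa [sq] using this

lemma r4_sq {t : ℝ} (ht : 0 < t) (x : ℝ) : r4 t x ^ 2 =
    r3 (2 * t) (2 * x) * r3 (2 * t) 0 - r2 (2 * t) (2 * x) * r2 (2 * t) 0 := by
  rw [r4, r3_sq ht, show 2 * (x + 1 / 2) = 2 * x + 1 by ring, r3_add_one, r2_add_one]
  ring

lemma r1_sq {t : ℝ} (ht : 0 < t) (x : ℝ) : r1 t x ^ 2 =
    r3 (2 * t) (2 * x) * r2 (2 * t) 0 - r2 (2 * t) (2 * x) * r3 (2 * t) 0 := by
  have h3 := r3_add_one (2 * t) (2 * x - 1)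
  have h2 := r2_add_one (2 * t) (2 * x - 1)
  rw [sub_add_cancel] at h3 h2
  rw [r1, r2_sq ht, show 2 * (x - 1 / 2) = 2 * x - 1 by ring, h3, h2]
  ring

lemma r_jacobi {t : ℝ} (ht : 0 < t) : r4 t 0 ^ 4 + r2 t 0 ^ 4 = r3 t 0 ^ 4 := by
  have h3 := r3_sq ht 0
  have h2 := r2_sq ht 0
  have h4 := r4_sq ht 0
  rw [mul_zero] at h2 h3 h4
  rw [show r4 t 0 ^ 4 = (r4 t 0 ^ 2) ^ 2 by ring, show r2 t 0 ^ 4 = (r2 t 0 ^ 2) ^ 2 by ring,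
    show r3 t 0 ^ 4 = (r3 t 0 ^ 2) ^ 2 by ring, h3, h2, h4]
  ring

lemma eS_sq_add {t : ℝ} (ht : 0 < t) (x : ℝ) : eS t x ^ 2 + eC t x ^ 2 = 1 := by
  have h30 := r3_sq ht 0
  have h20 := r2_sq ht 0
  have h40 := r4_sq ht 0
  have h2 := r2_sq ht x
  have h4 := r4_sq ht x
  have h1 := r1_sq ht x
  rw [mul_zero] at h20 h30 h40
  have p2 := (r2_zero_pos ht).ne'
  have p4 := (r4_pos ht x).ne'
  rw [eS, eC]
  field_simp
  rw [h30, h20, h40, h2, h4, h1]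
  ring

lemma eD_sq_add {t : ℝ} (ht : 0 < t) (x : ℝ) : eD t x ^ 2 + elam t * eS t x ^ 2 = 1 := by
  have h30 := r3_sq ht 0
  have h20 := r2_sq ht 0
  have h40 := r4_sq ht 0
  have h3 := r3_sq ht x
  have h4 := r4_sq ht x
  have h1 := r1_sq ht x
  rw [mul_zero] at h20 h30 h40
  have p2 := (r2_zero_pos ht).ne'
  have p3 := (r3_pos ht 0).ne'
  have p4 := (r4_pos ht x).ne'
  rw [eS, eD, elam]
  field_simp
  rw [h30, h20, h40, h3, h4, h1]
  ring

lemma elam_pos {t : ℝ} (ht : 0 < t) : 0 < elam t := by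
  have := r2_zero_pos ht
  have := r3_pos ht 0
  unfold elam
  positivity

lemma elam_eq {t : ℝ} (ht : 0 < t) : elam t = 1 - (r4 t 0 / r3 t 0) ^ 4 := by
  have := r_jacobi ht
  have p3 := (r3_pos ht 0).ne'
  rw [elam]
  field_simp
  linarith

lemma elam_lt_one {t : ℝ} (ht : 0 < t) : elam t < 1 := by
  rw [elam_eq ht]
  have := r4_pos ht 0
  have := r3_pos ht 0
  have : 0 < (r4 t 0 / r3 t 0) ^ 4 := by positivity
  linarith

lemma elam_inv {t : ℝ} (ht : 0 < t) : elam (1 / t) = 1 - elam t := by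
  rw [elam_eq ht, elam, r4_zero ht, r3_zero ht]
  have := (Real.sqrt_pos.mpr ht).ne'
  have p3 := (r3_pos (by positivity : 0 < 1 / t) 0).ne'
  field_simp
  ring

lemma eE_inv {t : ℝ} (ht : 0 < t) : eE (1 / t) = t * eE t := by
  have h := (Real.sqrt_pos.mpr ht).ne'
  have p3 := (r3_pos (by positivity : 0 < 1 / t) 0).ne'
  have p4 := (r4_pos (by positivity : 0 < 1 / t) 0).ne'
  have p2 := (r2_zero_pos (by positivity : 0 < 1 / t)).ne'
  rw [eE, eE, r1_deriv_zero ht, r3_zero ht, r2_zero ht, r4_zero ht]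
  generalize 1 / t = t' at *
  field_simp

lemma hda_comp (f g : ℝ → ℝ) {a b x : ℝ} (hf : HasDerivAt f a (g x)) (hg : HasDerivAt g b x) :
    HasDerivAt (fun y => f (g y)) (a * b) x := HasDerivAt.comp x hf hg

lemma r4_deriv_zero {t : ℝ} (ht : 0 < t) : HasDerivAt (r4 t) 0 0 := by
  have h := (r4_differentiable ht 0).hasDerivAt
  have hev : (fun x => r4 t (-x)) = r4 t := by
    funext x
    rw [r4, r4, ← r3_neg t (x + 1 / 2), ← r3_add_one t (-(x + 1 / 2))]
    congr 1; ring
  have h2 : HasDerivAt (fun x => r4 t (-x)) (deriv (r4 t) 0 * -1) 0 := by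
    have h' : HasDerivAt (r4 t) (deriv (r4 t) 0) (-0) := by rwa [neg_zero]
    exact hda_comp (r4 t) (fun y => -y) h' (hasDerivAt_neg 0)
  rw [hev] at h2
  have := h.unique h2
  have h0 : deriv (r4 t) 0 = 0 := by linarith
  rwa [h0] at h

lemma r34 {t : ℝ} (ht : 0 < t) (x : ℝ) :
    r3 t x * r4 t x = r4 (2 * t) (2 * x) * r4 (2 * t) 0 := by
  have h := r3_mul ht (x + 1 / 4) (1 / 4)
  rw [show 2 * (1 / 4 : ℝ) = 1 / 2 by norm_num, r2_half, mul_zero, add_zero] at h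
  rw [r4, r4, r4, mul_comm]
  convert h using 2 <;> ring_nf

lemma wronskian {t : ℝ} (ht : 0 < t) (x : ℝ) :
    deriv (r1 t) x * r2 t x - r1 t x * deriv (r2 t) x =
      2 * deriv (r1 (2 * t)) 0 * r4 (2 * t) (2 * x) := by
  have h2t : 0 < 2 * t := by linarith
  have a1 : HasDerivAt (fun y : ℝ => r1 t (x + y)) (deriv (r1 t) x * 1) 0 := by
    have h' : HasDerivAt (r1 t) (deriv (r1 t) x) (x + 0) := by
      rw [add_zero]; exact (r1_differentiable ht x).hasDerivAt
    exact hda_comp (r1 t) (fun y => x + y) h' ((hasDerivAt_id' 0).const_add x)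
  have a2 : HasDerivAt (fun y : ℝ => r2 t (x - y)) (deriv (r2 t) x * -1) 0 := by
    have h' : HasDerivAt (r2 t) (deriv (r2 t) x) (x - 0) := by
      rw [sub_zero]; exact (r2_differentiable ht x).hasDerivAt
    exact hda_comp (r2 t) (fun y => x - y) h' ((hasDerivAt_id' 0).const_sub x)
  have b1 : HasDerivAt (fun y : ℝ => r1 (2 * t) (2 * y)) (deriv (r1 (2 * t)) 0 * (2 * 1)) 0 := by
    have h' : HasDerivAt (r1 (2 * t)) (deriv (r1 (2 * t)) 0) (2 * 0) := by
      rw [mul_zero]; exact (r1_differentiable h2t 0).hasDerivAt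
    exact hda_comp (r1 (2 * t)) (fun y => 2 * y) h' ((hasDerivAt_id' (0 : ℝ)).const_mul (2 : ℝ))
  have b2 : HasDerivAt (fun y : ℝ => r4 (2 * t) (2 * y)) (0 * (2 * 1)) 0 := by
    have h' : HasDerivAt (r4 (2 * t)) 0 (2 * 0) := by
      rw [mul_zero]; exact r4_deriv_zero h2t
    exact hda_comp (r4 (2 * t)) (fun y => 2 * y) h' ((hasDerivAt_id' (0 : ℝ)).const_mul (2 : ℝ))
  have hl := a1.fun_mul a2
  have hr := (b2.const_mul (r1 (2 * t) (2 * x))).fun_add (b1.const_mul (r4 (2 * t) (2 * x)))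
  have he : (fun y => r1 t (x + y) * r2 t (x - y)) = fun y => r1 (2 * t) (2 * x) * r4 (2 * t) (2 * y) + r4 (2 * t) (2 * x) * r1 (2 * t) (2 * y) := by
    funext y; exact r1_mul_r2 ht x y
  rw [he] at hl
  have := hl.unique hr
  rw [add_zero, sub_zero] at this
  linarith

lemma wronskian' {t : ℝ} (ht : 0 < t) (x : ℝ) :
    deriv (r1 t) x * r2 t x - r1 t x * deriv (r2 t) x =
      (eE t * r2 t 0 ^ 2 / r3 t 0 ^ 2) * (r3 t x * r4 t x) := by
  have h := wronskian ht x
  have h0 := wronskian ht 0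
  have g := r34 ht x
  have g0 := r34 ht 0
  have p2 := (r2_zero_pos ht).ne'
  have p3 := (r3_pos ht 0).ne'
  have p4 := (r4_pos ht 0).ne'
  rw [mul_zero] at g0 h0
  rw [r1_zero, zero_mul, sub_zero] at h0
  have hd : deriv (r1 t) 0 = eE t * (r2 t 0 * r4 t 0) / r3 t 0 := by
    rw [eE]; field_simp
  rw [hd] at h0
  rw [h, g]
  have : eE t * r2 t 0 ^ 2 / r3 t 0 ^ 2 = 2 * deriv (r1 (2 * t)) 0 * r4 (2 * t) 0 / (r3 t 0 * r4 t 0) := by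
    rw [← h0]; field_simp
  rw [this, g0]
  have p4' := (r4_pos (by linarith : 0 < 2 * t) 0).ne'
  field_simp

lemma eS_hasDerivAt {t : ℝ} (ht : 0 < t) (x : ℝ) :
    HasDerivAt (eS t) (eE t * eC t x * eD t x) x := by
  have p2 := (r2_zero_pos ht).ne'
  have p3 := (r3_pos ht 0).ne'
  have p40 := (r4_pos ht 0).ne'
  have p4 := (r4_pos ht x).ne'
  have d1 := (r1_differentiable ht x).hasDerivAt
  have d2 := (r2_differentiable ht x).hasDerivAt
  have d4 := (r4_differentiable ht x).hasDerivAt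
  have hs : HasDerivAt (eS t) _ x := (d1.fun_div d4 p4).const_mul (r3 t 0 / r2 t 0)
  have hc : HasDerivAt (eC t) _ x := (d2.fun_div d4 p4).const_mul (r4 t 0 / r2 t 0)
  have w := wronskian' ht x
  have sq := eS_sq_add ht x
  have dsq := (hs.fun_pow 2).fun_add (hc.fun_pow 2)
  have hone : (fun y => eS t y ^ 2 + eC t y ^ 2) = fun _ => (1 : ℝ) := by
    funext y; exact eS_sq_add ht y
  rw [hone] at dsq
  have z := dsq.unique (hasDerivAt_const x (1 : ℝ))
  have cross : (r3 t 0 / r2 t 0 * ((deriv (r1 t) x * r4 t x - r1 t x * deriv (r4 t) x) / r4 t x ^ 2)) * eC t x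
     - eS t x * (r4 t 0 / r2 t 0 * ((deriv (r2 t) x * r4 t x - r2 t x * deriv (r4 t) x) / r4 t x ^ 2)) = eE t * eD t x := by
    have : eE t * eD t x = (r3 t 0 * r4 t 0 / r2 t 0 ^ 2) * ((eE t * r2 t 0 ^ 2 / r3 t 0 ^ 2) * (r3 t x * r4 t x)) / r4 t x ^ 2 := by
      rw [eD]; field_simp
    rw [this, ← w, eS, eC]
    field_simp
    ring
  have fin : eE t * eC t x * eD t x = (r3 t 0 / r2 t 0 * ((deriv (r1 t) x * r4 t x - r1 t x * deriv (r4 t) x) / r4 t x ^ 2)) := by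
    generalize (r3 t 0 / r2 t 0 * ((deriv (r1 t) x * r4 t x - r1 t x * deriv (r4 t) x) / r4 t x ^ 2)) = s' at *
    generalize (r4 t 0 / r2 t 0 * ((deriv (r2 t) x * r4 t x - r2 t x * deriv (r4 t) x) / r4 t x ^ 2)) = c' at *
    norm_num at z
    linear_combination (-eC t x) * cross + s' * sq - eS t x / 2 * z
  rw [fin]
  exact hs

lemma eS_zero (t : ℝ) : eS t 0 = 0 := by rw [eS, r1_zero]; simp

lemma eS_half {t : ℝ} (ht : 0 < t) : eS t (1 / 2) = 1 := by
  have p2 := (r2_zero_pos ht).ne'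
  have p3 := (r3_pos ht 0).ne'
  have h : r3 t (1 / 2 + 1 / 2) = r3 t 0 := by
    rw [← r3_add_one t 0]; norm_num
  rw [eS, r1, r4, sub_self, h]
  field_simp

lemma eC_pos {t : ℝ} (ht : 0 < t) {x : ℝ} (hx : x ∈ Ioo (-(1 / 2) : ℝ) (1 / 2)) :
    0 < eC t x := by
  have := r2_pos ht hx
  have := r4_pos ht x
  have := r4_pos ht 0
  have := r2_zero_pos ht
  unfold eC; positivity

lemma eD_pos {t : ℝ} (ht : 0 < t) (x : ℝ) : 0 < eD t x := by
  have := r3_pos ht x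
  have := r4_pos ht x
  have := r4_pos ht 0
  have := r3_pos ht 0
  unfold eD; positivity

lemma eS_continuous {t : ℝ} (ht : 0 < t) : Continuous (eS t) :=
  continuous_iff_continuousAt.mpr fun x => (eS_hasDerivAt ht x).continuousAt

lemma eE_pos {t : ℝ} (ht : 0 < t) : 0 < eE t := by
  obtain ⟨c, hc, h⟩ := exists_hasDerivAt_eq_slope (eS t) (fun x => eE t * eC t x * eD t x)
    (show (0 : ℝ) < 1 / 2 by norm_num) (eS_continuous ht).continuousOn
    (fun x _ => eS_hasDerivAt ht x)
  rw [eS_half ht, eS_zero] at h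
  have h1 := eC_pos ht (x := c) ⟨by linarith [hc.1], hc.2⟩
  have h2 := eD_pos ht c
  by_contra hn
  have : eE t * eC t c * eD t c ≤ 0 :=
    mul_nonpos_of_nonpos_of_nonneg (mul_nonpos_of_nonpos_of_nonneg (not_lt.mp hn) h1.le) h2.le
  norm_num at h
  linarith

lemma eS_strictMono {t : ℝ} (ht : 0 < t) : StrictMonoOn (eS t) (Icc 0 (1 / 2)) := by
  apply strictMonoOn_of_deriv_pos (convex_Icc _ _) (eS_continuous ht).continuousOn
  intro x hx
  rw [interior_Icc] at hx
  rw [(eS_hasDerivAt ht x).deriv]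
  have h1 := eC_pos ht (x := x) ⟨by linarith [hx.1], hx.2⟩
  have h2 := eD_pos ht x
  have := eE_pos ht
  positivity

lemma eD_mul_eS {t : ℝ} (ht : 0 < t) (x : ℝ) : eD t x * eS t (1 / 2 - x) = eC t x := by
  have p2 := (r2_zero_pos ht).ne'
  have p3 := (r3_pos ht 0).ne'
  have p3x := (r3_pos ht x).ne'
  have p4 := (r4_pos ht x).ne'
  have h : r4 t (1 / 2 - x) = r3 t x := by
    rw [r4, ← r3_neg t x, ← r3_add_one t (-x)]; congr 1; ring
  rw [eD, eS, eC, ← r2_eq_r1, h]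
  field_simp

lemma eS_quarter {t : ℝ} (ht : 0 < t) : 1 / 2 < eS t (1 / 4) ^ 2 := by
  have h := eS_sq_add ht (1 / 4)
  have p2 := (r2_zero_pos ht).ne'
  have q2 := r2_zero_pos ht
  have p3 := r3_pos ht 0
  have p40 := r4_pos ht 0
  have p4 := (r4_pos ht (1 / 4)).ne'
  have hc : eC t (1 / 4) = r4 t 0 / r3 t 0 * eS t (1 / 4) := by
    have e : r1 t (1 / 4) = r2 t (1 / 4) := by rw [r2_eq_r1]; norm_num
    rw [eC, eS, e]
    field_simp
  rw [hc, mul_pow] at h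
  have hk : (r4 t 0 / r3 t 0) ^ 2 < 1 := by
    rw [div_pow, div_lt_one (by positivity)]
    have := r_jacobi ht
    have : 0 < r2 t 0 ^ 4 := by positivity
    have hp : 0 < r3 t 0 ^ 2 + r4 t 0 ^ 2 := by positivity
    nlinarith
  have hp : 0 < (r4 t 0 / r3 t 0) ^ 2 := by positivity
  by_contra hn
  have := sq_nonneg (eS t (1 / 4))
  nlinarith

def fK (μ s : ℝ) : ℝ := 1 / (Real.sqrt (1 - s ^ 2) * Real.sqrt (1 - μ * s ^ 2))

lemma fK_measurable (μ : ℝ) : Measurable (fK μ) := by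
  unfold fK; fun_prop

lemma fK_pos {μ s : ℝ} (hμ : μ < 1) (hs : s ∈ Ioo (0 : ℝ) 1) : 0 < fK μ s := by
  have h1 : 0 < 1 - s ^ 2 := by nlinarith [hs.1, hs.2]
  have h2 : 0 < 1 - μ * s ^ 2 := by nlinarith [hs.1, hs.2, sq_nonneg s]
  have := Real.sqrt_pos.mpr h1
  have := Real.sqrt_pos.mpr h2
  unfold fK; positivity

lemma eS_image {t : ℝ} (ht : 0 < t) {x : ℝ} (hx : x ∈ Ioc (0 : ℝ) (1 / 2)) :
    eS t '' Ioo 0 x = Ioo 0 (eS t x) := by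
  have hm := eS_strictMono ht
  apply Subset.antisymm
  · rintro _ ⟨y, hy, rfl⟩
    constructor
    · have := hm (left_mem_Icc.mpr (by norm_num)) ⟨hy.1.le, hy.2.le.trans hx.2⟩ hy.1
      rwa [eS_zero] at this
    · exact hm ⟨hy.1.le, hy.2.le.trans hx.2⟩ ⟨hx.1.le, hx.2⟩ hy.2
  · have := intermediate_value_Ioo hx.1.le (eS_continuous ht).continuousOn
    rwa [eS_zero] at this

lemma eS_fK {t : ℝ} (ht : 0 < t) {y : ℝ} (hy : y ∈ Ioo (0 : ℝ) (1 / 2)) :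
    |eE t * eC t y * eD t y| • fK (elam t) (eS t y) = eE t := by
  have hc := eC_pos ht ⟨by linarith [hy.1], hy.2⟩
  have hd := eD_pos ht y
  have he := eE_pos ht
  have h1 : 1 - eS t y ^ 2 = eC t y ^ 2 := by linarith [eS_sq_add ht y]
  have h2 : 1 - elam t * eS t y ^ 2 = eD t y ^ 2 := by linarith [eD_sq_add ht y]
  rw [fK, h1, h2, Real.sqrt_sq hc.le, Real.sqrt_sq hd.le, abs_of_pos (by positivity), smul_eq_mul]
  field_simp

lemma fK_int {t : ℝ} (ht : 0 < t) {x : ℝ} (hx : x ∈ Ioc (0 : ℝ) (1 / 2)) :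
    MeasureTheory.IntegrableOn (fK (elam t)) (Ioo 0 (eS t x)) ∧
    ∫ s in Ioo 0 (eS t x), fK (elam t) s = eE t * x := by
  have hinj : InjOn (eS t) (Ioo 0 x) :=
    (eS_strictMono ht).injOn.mono
      (fun y hy => ⟨hy.1.le, hy.2.le.trans hx.2⟩ : Ioo 0 x ⊆ Icc 0 (1 / 2))
  have hd : ∀ y ∈ Ioo 0 x,
      HasDerivWithinAt (eS t) ((fun y => eE t * eC t y * eD t y) y) (Ioo 0 x) y :=
    fun y _ => (eS_hasDerivAt ht y).hasDerivWithinAt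
  have hcongr : EqOn (fun y => |eE t * eC t y * eD t y| • fK (elam t) (eS t y)) (fun _ => eE t)
    (Ioo 0 x) := fun y hy => eS_fK ht ⟨hy.1, hy.2.trans_le hx.2⟩
  rw [← eS_image ht hx]
  constructor
  · rw [MeasureTheory.integrableOn_image_iff_integrableOn_abs_deriv_smul measurableSet_Ioo hd hinj]
    rw [MeasureTheory.integrableOn_congr_fun hcongr measurableSet_Ioo]
    exact MeasureTheory.integrableOn_const (by simp)
  · rw [MeasureTheory.integral_image_eq_integral_abs_deriv_smul measurableSet_Ioo hd hinj,
      MeasureTheory.setIntegral_congr_fun measurableSet_Ioo hcongr]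
    simp [hx.1.le, mul_comm]

lemma elam_one : elam 1 = 1 / 2 := by
  have := elam_inv (t := 1) one_pos
  rw [div_one] at this
  linarith

lemma fK_integrable {μ : ℝ} (hμ : μ < 1) :
    MeasureTheory.IntegrableOn (fK μ) (Ioo 0 1) := by
  have h := (fK_int (t := 1) one_pos (x := 1 / 2) ⟨by norm_num, le_rfl⟩).1
  rw [eS_half one_pos, elam_one] at h
  have h0 : 0 < 1 - max μ 0 := by
    rcases max_cases μ 0 with h | h <;> rw [h.1] <;> linarith
  refine MeasureTheory.Integrable.mono' (h.const_mul (1 / Real.sqrt (1 - max μ 0)))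
    (fK_measurable μ).aestronglyMeasurable ?_
  refine (MeasureTheory.ae_restrict_iff' measurableSet_Ioo).mpr (Eventually.of_forall ?_)
  intro s hs
  rw [Real.norm_of_nonneg (fK_pos hμ hs).le]
  have hs1 : s ^ 2 < 1 := by nlinarith [hs.1, hs.2]
  have a := Real.sqrt_pos.mpr (show 0 < 1 - s ^ 2 by linarith)
  have hpos : 0 < 1 - 1 / 2 * s ^ 2 := by linarith
  have b := Real.sqrt_pos.mpr hpos
  have b1 : Real.sqrt (1 - 1 / 2 * s ^ 2) ≤ 1 := by
    rw [Real.sqrt_le_one]; nlinarith [sq_nonneg s]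
  have c := Real.sqrt_pos.mpr h0
  have hle : 1 - max μ 0 ≤ 1 - μ * s ^ 2 := by
    have : μ * s ^ 2 ≤ max μ 0 := by
      calc μ * s ^ 2 ≤ max μ 0 * s ^ 2 := by gcongr; exact le_max_left _ _
        _ ≤ max μ 0 * 1 := by
          have : 0 ≤ max μ 0 := le_max_right _ _
          gcongr
        _ = _ := mul_one _
    linarith
  have d := Real.sqrt_le_sqrt hle
  rw [fK, fK, div_mul_div_comm, one_mul]
  apply one_div_le_one_div_of_le (by positivity)
  calc Real.sqrt (1 - max μ 0) * (Real.sqrt (1 - s ^ 2) * Real.sqrt (1 - 1 / 2 * s ^ 2))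
      ≤ Real.sqrt (1 - μ * s ^ 2) * (Real.sqrt (1 - s ^ 2) * 1) := by gcongr
    _ = _ := by ring

lemma ellK_eq_s17 {μ : ℝ} (hμ : μ < 1) : ellK (μ : ℂ) = ((∫ s in Ioo (0 : ℝ) 1, fK μ s : ℝ) : ℂ) := by
  rw [ellK, intervalIntegral.integral_of_le zero_le_one,
    MeasureTheory.integral_Ioc_eq_integral_Ioo, ← integral_complex_ofReal]
  apply MeasureTheory.setIntegral_congr_fun measurableSet_Ioo
  intro s hs
  have h1 : 0 < 1 - s ^ 2 := by nlinarith [hs.1, hs.2]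
  have h2 : 0 < 1 - μ * s ^ 2 := by nlinarith [hs.1, hs.2, sq_nonneg s]
  have e : (1 - (s : ℂ) ^ 2) * (1 - (μ : ℂ) * (s : ℂ) ^ 2) =
    (((1 - s ^ 2) * (1 - μ * s ^ 2) : ℝ) : ℂ) := by push_cast; ring
  have e2 : ((1 : ℂ) / 2) = (((1 / 2 : ℝ)) : ℂ) := by push_cast; ring
  simp only
  rw [e, e2, ← Complex.ofReal_cpow (by positivity), ← Real.sqrt_eq_rpow, Real.sqrt_mul h1.le, fK]
  push_cast; rfl

lemma KR_eq_s17 {μ : ℝ} (hμ : μ < 1) : KR μ = ∫ s in Ioo (0 : ℝ) 1, fK μ s := by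
  rw [KR, ellK_eq_s17 hμ, Complex.ofReal_re]

lemma ellK_KR_s17 {μ : ℝ} (hμ : μ < 1) : ellK (μ : ℂ) = (KR μ : ℂ) := by
  rw [KR_eq_s17 hμ, ellK_eq_s17 hμ]

lemma setInt_lt {f g : ℝ → ℝ} {a b : ℝ} (hab : a < b) (hf : MeasureTheory.IntegrableOn f (Ioo a b))
    (hg : MeasureTheory.IntegrableOn g (Ioo a b)) (h : ∀ s ∈ Ioo a b, f s < g s) :
    ∫ s in Ioo a b, f s < ∫ s in Ioo a b, g s := by
  have : 0 < ∫ s in Ioo a b, (g s - f s) := by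
    rw [MeasureTheory.setIntegral_pos_iff_support_of_nonneg_ae]
    · have : Ioo a b ⊆ (Function.support fun s => g s - f s) ∩ Ioo a b := by
        intro s hs
        refine ⟨?_, hs⟩
        simp only [Function.mem_support]
        linarith [h s hs]
      refine lt_of_lt_of_le ?_ (MeasureTheory.measure_mono this)
      simp [hab]
    · refine (MeasureTheory.ae_restrict_iff' measurableSet_Ioo).mpr (Eventually.of_forall ?_)
      intro s hs
      simp only [Pi.zero_apply]
      linarith [h s hs]
    · exact hg.sub hf
  rw [MeasureTheory.integral_sub hg hf] at this
  linarith

lemma KR_pos_s17 {μ : ℝ} (hμ : μ < 1) : 0 < KR μ := by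
  rw [KR_eq_s17 hμ]
  have := setInt_lt (f := fun _ => 0) zero_lt_one MeasureTheory.integrableOn_zero
    (fK_integrable hμ) (fun s hs => fK_pos hμ hs)
  simpa using this

lemma KR_lt {μ ν : ℝ} (hν : ν < 1) (h : μ < ν) : KR μ < KR ν := by
  rw [KR_eq_s17 hν, KR_eq_s17 (h.trans hν)]
  refine setInt_lt zero_lt_one (fK_integrable (h.trans hν)) (fK_integrable hν) fun s hs => ?_
  have h1 : 0 < 1 - s ^ 2 := by nlinarith [hs.1, hs.2]
  have hs0 : 0 < s ^ 2 := by have := hs.1; positivity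
  have h2 : 0 < 1 - ν * s ^ 2 := by nlinarith
  have a := Real.sqrt_pos.mpr h1
  have b := Real.sqrt_pos.mpr h2
  have c : Real.sqrt (1 - ν * s ^ 2) < Real.sqrt (1 - μ * s ^ 2) :=
    Real.sqrt_lt_sqrt h2.le (by nlinarith)
  rw [fK, fK]
  apply one_div_lt_one_div_of_lt (by positivity)
  gcongr

lemma KR_elam {t : ℝ} (ht : 0 < t) : KR (elam t) = eE t / 2 := by
  have := (fK_int ht (x := 1 / 2) ⟨by norm_num, le_rfl⟩).2
  rw [eS_half ht] at this
  rw [KR_eq_s17 (elam_lt_one ht), this]; ring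

lemma KR_ratio {t : ℝ} (ht : 0 < t) : KR (1 - elam t) / KR (elam t) = t := by
  have h : 0 < 1 / t := by positivity
  rw [← elam_inv ht, KR_elam h, KR_elam ht, eE_inv ht]
  have := (eE_pos ht).ne'
  field_simp

lemma ratio_lt {μ ν : ℝ} (hμ : 0 < μ) (hν : ν < 1) (h : μ < ν) :
    KR (1 - ν) / KR ν < KR (1 - μ) / KR μ := by
  have a := KR_lt hν h
  have b := KR_lt (show 1 - μ < 1 by linarith) (show 1 - ν < 1 - μ by linarith)
  have c := KR_pos_s17 (h.trans hν)
  have d := KR_pos_s17 (show 1 - ν < 1 by linarith)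
  have e := d.trans b
  gcongr

lemma elam_ratio {μ : ℝ} (h0 : 0 < μ) (h1 : μ < 1) :
    0 < KR (1 - μ) / KR μ ∧ elam (KR (1 - μ) / KR μ) = μ := by
  have c := KR_pos_s17 h1
  have d := KR_pos_s17 (show 1 - μ < 1 by linarith)
  have ht : 0 < KR (1 - μ) / KR μ := by positivity
  refine ⟨ht, ?_⟩
  have r := KR_ratio ht
  set t := KR (1 - μ) / KR μ with hdef
  rcases lt_trichotomy (elam t) μ with h | h | h
  · have := ratio_lt (elam_pos ht) h1 h
    rw [r, ← hdef] at this; exact absurd this (lt_irrefl _)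
  · exact h
  · have := ratio_lt h0 (elam_lt_one ht) h
    rw [r, ← hdef] at this; exact absurd this (lt_irrefl _)

lemma jacobi_param {μ : ℝ} (h0 : 0 < μ) (h1 : μ < 1) :
    ∃ t : ℝ, 0 < t ∧ elam t = μ ∧ ∀ u : ℝ, snR (KR μ * u) μ = eS t (u / 2) ∧
      cnR (KR μ * u) μ = eC t (u / 2) ∧ dnR (KR μ * u) μ = eD t (u / 2) := by
  obtain ⟨ht, hl⟩ := elam_ratio h0 h1
  refine ⟨_, ht, hl, ?_⟩
  have k := ((KR_pos_s17 h1).ne')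
  have hn : nome (μ : ℂ) = cexp (-(Real.pi : ℂ) * ((KR (1 - μ) / KR μ : ℝ) : ℂ)) := by
    rw [nome, ellK_KR_s17 h1, show (1 : ℂ) - (μ : ℂ) = ((1 - μ : ℝ) : ℂ) by push_cast; ring,
      ellK_KR_s17 (by linarith : 1 - μ < 1)]
    congr 1; push_cast; ring
  have hz : ∀ u : ℝ, (Real.pi : ℂ) * ((KR μ * u : ℝ) : ℂ) / (2 * ellK (μ : ℂ)) =
      (Real.pi : ℂ) * ((u / 2 : ℝ) : ℂ) := by
    intro u
    have : (KR μ : ℂ) ≠ 0 := by exact_mod_cast k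
    rw [ellK_KR_s17 h1]; push_cast; field_simp
  have z0 : (0 : ℂ) = (Real.pi : ℂ) * ((0 : ℝ) : ℂ) := by simp
  generalize KR (1 - μ) / KR μ = t at *
  intro u
  refine ⟨?_, ?_, ?_⟩
  · rw [snR, sn, hn, hz, z0, theta1_eq ht, theta2_eq_s17 ht, theta3_eq_s17 ht, theta4_eq_s17 ht, eS]
    norm_cast
  · rw [cnR, cn, hn, hz, z0, theta4_eq_s17 ht, theta2_eq_s17 ht, theta2_eq_s17 ht, theta4_eq_s17 ht, eC]
    norm_cast
  · rw [dnR, dn, hn, hz, z0, theta3_eq_s17 ht, theta4_eq_s17 ht, theta3_eq_s17 ht, theta4_eq_s17 ht, eD]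
    norm_cast

lemma fK_split {μ y : ℝ} (hμ : μ < 1) (hy : y ∈ Ioo (0 : ℝ) 1) :
    ∫ s in Ioo (0 : ℝ) 1, fK μ s = (∫ s in Ioo 0 y, fK μ s) + ∫ s in Ico y 1, fK μ s := by
  have h := fK_integrable hμ
  rw [← MeasureTheory.setIntegral_union _ measurableSet_Ico
    (h.mono_set (Ioo_subset_Ioo_right hy.2.le))
    (h.mono_set (fun s hs => ⟨hy.1.trans_le hs.1, hs.2⟩)), Ioo_union_Ico_eq_Ioo hy.1 hy.2.le]
  rw [Set.disjoint_left]
  intro s hs hs'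
  exact absurd hs.2 (not_lt.mpr hs'.1)

lemma fK_cmp {μ ν s y : ℝ} (hν : ν < 1) (h : μ ≤ ν) (hs : s ∈ Ioo (0 : ℝ) 1)
    (hy : y ∈ Ioo (0 : ℝ) 1) (hsy : s ≤ y) : fK ν s * fK μ y ≤ fK μ s * fK ν y := by
  have h1 : 0 < 1 - s ^ 2 := by nlinarith [hs.1, hs.2]
  have h2 : 0 < 1 - y ^ 2 := by nlinarith [hy.1, hy.2]
  have h3 : 0 < 1 - ν * s ^ 2 := by nlinarith [hs.1, hs.2, sq_nonneg s]
  have h4 : 0 < 1 - ν * y ^ 2 := by nlinarith [hy.1, hy.2, sq_nonneg y]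
  have h5 : 0 < 1 - μ * s ^ 2 := by nlinarith [hs.1, hs.2, sq_nonneg s]
  have h6 : 0 < 1 - μ * y ^ 2 := by nlinarith [hy.1, hy.2, sq_nonneg y]
  have hq : s ^ 2 ≤ y ^ 2 := by have := hs.1; gcongr
  have key : Real.sqrt (1 - μ * s ^ 2) * Real.sqrt (1 - ν * y ^ 2) ≤
      Real.sqrt (1 - ν * s ^ 2) * Real.sqrt (1 - μ * y ^ 2) := by
    rw [← Real.sqrt_mul h5.le, ← Real.sqrt_mul h3.le]
    apply Real.sqrt_le_sqrt
    nlinarith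
  have a1 := Real.sqrt_pos.mpr h1
  have a2 := Real.sqrt_pos.mpr h2
  have a3 := Real.sqrt_pos.mpr h3
  have a4 := Real.sqrt_pos.mpr h4
  have a5 := Real.sqrt_pos.mpr h5
  have a6 := Real.sqrt_pos.mpr h6
  rw [fK, fK, fK, fK, div_mul_div_comm, div_mul_div_comm, one_mul]
  apply one_div_le_one_div_of_le (by positivity)
  calc _ = (Real.sqrt (1 - s ^ 2) * Real.sqrt (1 - y ^ 2)) *
        (Real.sqrt (1 - μ * s ^ 2) * Real.sqrt (1 - ν * y ^ 2)) := by ring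
    _ ≤ (Real.sqrt (1 - s ^ 2) * Real.sqrt (1 - y ^ 2)) *
        (Real.sqrt (1 - ν * s ^ 2) * Real.sqrt (1 - μ * y ^ 2)) := by gcongr
    _ = _ := by ring

lemma fK_ratio {μ ν y : ℝ} (hν : ν < 1) (h : μ ≤ ν) (hy : y ∈ Ioo (0 : ℝ) 1) :
    (∫ s in Ioo 0 y, fK ν s) * (∫ s in Ioo (0 : ℝ) 1, fK μ s) ≤
      (∫ s in Ioo 0 y, fK μ s) * ∫ s in Ioo (0 : ℝ) 1, fK ν s := by
  have hμ : μ < 1 := h.trans_lt hν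
  have iμ := fK_integrable hμ
  have iν := fK_integrable hν
  have sub1 : Ioo 0 y ⊆ Ioo 0 1 := Ioo_subset_Ioo_right hy.2.le
  have sub2 : Ico y 1 ⊆ Ioo 0 1 := fun s hs => ⟨hy.1.trans_le hs.1, hs.2⟩
  rw [fK_split hμ hy, fK_split hν hy]
  have p1 : (∫ s in Ioo 0 y, fK ν s) * fK μ y ≤ (∫ s in Ioo 0 y, fK μ s) * fK ν y := by
    rw [← MeasureTheory.integral_mul_const, ← MeasureTheory.integral_mul_const]
    exact MeasureTheory.setIntegral_mono_on ((iν.mono_set sub1).mul_const _)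
      ((iμ.mono_set sub1).mul_const _) measurableSet_Ioo
      fun s hs => fK_cmp hν h (sub1 hs) hy hs.2.le
  have p2 : (∫ s in Ico y 1, fK μ s) * fK ν y ≤ (∫ s in Ico y 1, fK ν s) * fK μ y := by
    rw [← MeasureTheory.integral_mul_const, ← MeasureTheory.integral_mul_const]
    refine MeasureTheory.setIntegral_mono_on ((iμ.mono_set sub2).mul_const _)
      ((iν.mono_set sub2).mul_const _) measurableSet_Ico
      fun s hs => ?_
    have := fK_cmp hν h hy (sub2 hs) hs.1
    linarith
  have n1 : 0 ≤ ∫ s in Ioo 0 y, fK μ s :=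
    MeasureTheory.setIntegral_nonneg measurableSet_Ioo fun s hs => (fK_pos hμ (sub1 hs)).le
  have n2 : 0 ≤ ∫ s in Ico y 1, fK μ s :=
    MeasureTheory.setIntegral_nonneg measurableSet_Ico fun s hs => (fK_pos hμ (sub2 hs)).le
  have q1 := fK_pos hμ hy
  have q2 := fK_pos hν hy
  generalize (∫ s in Ioo 0 y, fK ν s) = A at *
  generalize (∫ s in Ioo 0 y, fK μ s) = B at *
  generalize (∫ s in Ico y 1, fK ν s) = C at *
  generalize (∫ s in Ico y 1, fK μ s) = D at *
  have : A * D * fK μ y ≤ B * C * fK μ y := by nlinarith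
  have := le_of_mul_le_mul_right this q1
  linarith

lemma eS_mono_param {t t' x : ℝ} (ht : 0 < t) (ht' : 0 < t') (h : elam t ≤ elam t')
    (hx : x ∈ Ioo (0 : ℝ) (1 / 2)) : eS t x ≤ eS t' x := by
  have hhalf : (1 / 2 : ℝ) ∈ Ioc (0 : ℝ) (1 / 2) := ⟨by norm_num, le_rfl⟩
  have hxc : x ∈ Ioc (0 : ℝ) (1 / 2) := ⟨hx.1, hx.2.le⟩
  have hy : eS t x ∈ Ioo (0 : ℝ) 1 := by
    have := eS_image ht hhalf
    rw [eS_half ht] at this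
    rw [← this]; exact ⟨x, hx, rfl⟩
  have hy' := hy
  have him := eS_image ht' hhalf
  rw [eS_half ht'] at him
  rw [← him] at hy'
  obtain ⟨x', hx', he⟩ := hy'
  have r := fK_ratio (elam_lt_one ht') h hy
  have a1 := (fK_int ht hxc).2
  have a2 := (fK_int ht hhalf).2
  have b1 := (fK_int ht' ⟨hx'.1, hx'.2.le⟩).2
  have b2 := (fK_int ht' hhalf).2
  rw [eS_half ht] at a2
  rw [eS_half ht'] at b2
  rw [he] at b1
  rw [a1, a2, b1, b2] at r
  have e1 := eE_pos ht
  have e2 := eE_pos ht'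
  have hle : x' ≤ x := by
    have : x' * (eE t * eE t') ≤ x * (eE t * eE t') := by linarith
    exact le_of_mul_le_mul_right this (by positivity)
  rw [← he]
  exact (eS_strictMono ht').monotoneOn ⟨hx'.1.le, hx'.2.le⟩ ⟨hx.1.le, hx.2.le⟩ hle

/-- Core inequality. -/
lemma core {μ S T a b c d c1 d1 : ℝ} (hμ : 0 < μ) (hμ1 : μ < 1) (hS : S = a ^ 2) (hT : T = b ^ 2)
    (hc : a ^ 2 + c ^ 2 = 1) (hd : d ^ 2 + μ * a ^ 2 = 1) (hc1 : b ^ 2 + c1 ^ 2 = 1)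
    (hd1 : d1 ^ 2 + (1 - μ) * b ^ 2 = 1) (hc0 : 0 < c) (hc10 : 0 < c1)
    (hphi : d1 ^ 2 * c ^ 2 - d ^ 2 * c1 ^ 2 < c ^ 2 * c1 ^ 2) :
    μ * (a ^ 2 * d1 ^ 2 + c ^ 2 * d ^ 2 * b ^ 2 * c1 ^ 2) / (1 - d ^ 2 * b ^ 2) ^ 2 < 1 := by
  have C : c ^ 2 = 1 - S := by linarith
  have D : d ^ 2 = 1 - μ * S := by rw [hS]; linarith
  have C1 : c1 ^ 2 = 1 - T := by linarith
  have D1 : d1 ^ 2 = 1 - (1 - μ) * T := by rw [hT]; linarith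
  have pS : 0 < 1 - S := by rw [← C]; positivity
  have pT : 0 < 1 - T := by rw [← C1]; positivity
  have nS : 0 ≤ S := by rw [hS]; positivity
  have nT : 0 ≤ T := by rw [hT]; positivity
  have hden : 0 < 1 - T + μ * S * T := by positivity
  rw [C, D, C1, D1] at hphi
  rw [C, D, C1, D1, ← hS, ← hT]
  have e1 : 1 - (1 - μ * S) * T = 1 - T + μ * S * T := by ring
  have e2 : μ * (S * (1 - (1 - μ) * T) + (1 - S) * (1 - μ * S) * T * (1 - T)) =
    μ * (S + T - S * T) * (1 - T + μ * S * T) := by ring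
  rw [e1, e2, div_lt_one (by positivity), sq]
  apply mul_lt_mul_of_pos_right _ hden
  nlinarith

/-- For `(u,m)` with either `u ∈ (0,1/2]`, `m ∈ (1,∞)` or
`u ∈ (0,1)`, `m ∈ [2,∞)`, the continuously extended modulus
`|sn(K(m)u | m)| = √(μ(s²d₁² + c²d²s₁²c₁²)/(1 − d²s₁²)²)` is `< 1`. -/
theorem sn_abs_lt_one_cut (u m : ℝ)
    (h : (u ∈ Set.Ioc (0 : ℝ) (1 / 2) ∧ 1 < m) ∨ (u ∈ Set.Ioo (0 : ℝ) 1 ∧ 2 ≤ m)) :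
    Real.sqrt (snAbsSq u m) < 1 := by
  have hm : 1 < m := by rcases h with h | h <;> linarith [h.2]
  have hu : u ∈ Ioo (0 : ℝ) 1 := by
    rcases h with h | h
    · exact ⟨h.1.1, by linarith [h.1.2]⟩
    · exact h.1
  have hμ0 : 0 < 1 / m := by positivity
  have hμ1 : 1 / m < 1 := by rw [div_lt_one (by linarith)]; exact hm
  have hcase : u ≤ 1 / 2 ∨ 1 / m ≤ 1 / 2 := by
    rcases h with h | h
    · exact Or.inl h.1.2
    · exact Or.inr (one_div_le_one_div_of_le (by norm_num) h.2)
  simp only [snAbsSq]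
  generalize 1 / m = μ at *
  obtain ⟨t, ht, hl, hf⟩ := jacobi_param hμ0 hμ1
  obtain ⟨t', ht', hl', hf'⟩ := jacobi_param (μ := 1 - μ) (by linarith) (by linarith)
  obtain ⟨hs, hc, hd⟩ := hf u
  obtain ⟨hs', hc', hd'⟩ := hf' u
  rw [hs, hc, hd, hs', hc', hd', Real.sqrt_lt' one_pos, one_pow]
  have hx : u / 2 ∈ Ioo (-(1 / 2) : ℝ) (1 / 2) := ⟨by linarith [hu.1], by linarith [hu.2]⟩
  have hx' : 1 / 2 - u / 2 ∈ Ioo (0 : ℝ) (1 / 2) := ⟨by linarith [hu.2], by linarith [hu.1]⟩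
  have D := eD_sq_add ht (u / 2)
  have D' := eD_sq_add ht' (u / 2)
  rw [hl] at D
  rw [hl'] at D'
  have pc := eC_pos ht hx
  have pc' := eC_pos ht' hx
  have pd := eD_pos ht (u / 2)
  have pd' := eD_pos ht' (u / 2)
  refine core hμ0 hμ1 rfl rfl (eS_sq_add ht _) D (eS_sq_add ht' _) D' pc pc' ?_
  have g := eD_mul_eS ht (u / 2)
  have g' := eD_mul_eS ht' (u / 2)
  have him : ∀ {r : ℝ}, 0 < r → eS r (1 / 2 - u / 2) ∈ Ioo (0 : ℝ) 1 := by
    intro r hr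
    have := eS_image hr (x := 1 / 2) ⟨by norm_num, le_rfl⟩
    rw [eS_half hr] at this
    rw [← this]; exact ⟨_, hx', rfl⟩
  have i := him ht
  have i' := him ht'
  rw [← g, ← g']
  have hD : 0 < eD t (u / 2) ^ 2 * eD t' (u / 2) ^ 2 := by positivity
  suffices hh : eS t (1 / 2 - u / 2) ^ 2 - eS t' (1 / 2 - u / 2) ^ 2 <
      eS t (1 / 2 - u / 2) ^ 2 * eS t' (1 / 2 - u / 2) ^ 2 by
    have := mul_lt_mul_of_pos_left hh hD
    linarith
  rcases hcase with hc | hc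
  · have q := eS_quarter ht'
    have mono := (eS_strictMono ht').monotoneOn (a := 1 / 4) (b := 1 / 2 - u / 2)
      ⟨by norm_num, by norm_num⟩ ⟨hx'.1.le, hx'.2.le⟩ (by linarith)
    have p4 : 0 ≤ eS t' (1 / 4) := by
      have := (eS_strictMono ht').monotoneOn (a := 0) (b := 1 / 4)
        ⟨le_rfl, by norm_num⟩ ⟨by norm_num, by norm_num⟩ (by norm_num)
      rwa [eS_zero] at this
    have q2 : eS t' (1 / 4) ^ 2 ≤ eS t' (1 / 2 - u / 2) ^ 2 := by gcongr
    have y0 : 0 < eS t (1 / 2 - u / 2) ^ 2 := by have := i.1; positivity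
    have y1 : eS t (1 / 2 - u / 2) ^ 2 < 1 := by nlinarith [i.1, i.2]
    nlinarith
  · have mono := eS_mono_param ht ht' (by rw [hl, hl']; linarith) hx'
    have q2 : eS t (1 / 2 - u / 2) ^ 2 ≤ eS t' (1 / 2 - u / 2) ^ 2 := by
      have := i.1.le
      gcongr
    have : 0 < eS t (1 / 2 - u / 2) ^ 2 * eS t' (1 / 2 - u / 2) ^ 2 := by
      have := i.1; have := i'.1; positivity
    linarith
end
end
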